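/- arXiv:math/0303068 — 4 statements merged into one kernel-verified Lean document; each statement's English description precedes it below -/
import Mathlib

section
/- Let H be a cocommutative Hopf algebra over a field k, let A be a unital k-algebra equipped with a weak action of H, and let σ : H⊗H → k·1_A be a convolution invertible map taking values in the scalar multiples of 1_A which satisfies the normality, cocycle and twisted module properties. Then the weak action is an action, i.e. h(l(a)) = (hl)(a) for all h,l ∈ H and a ∈ A; in particular A is an H-module algebra. -/
open TensorProduct

noncomputable section

/-! ## Tensor powers, iterated comultiplication and Sweedler representations -/

/-- `Tpow k V n` is the `(n+1)`-fold tensor power `V ⊗ V ⊗ ⋯ ⊗ V` (`n+1` factors),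
bundled as an object of `ModuleCat k`. -/
def Tpow (k : Type) [Field k] (V : Type) [AddCommGroup V] [Module k V] : ℕ → ModuleCat k
  | 0 => ModuleCat.of k V
  | n + 1 => ModuleCat.of k (V ⊗[k] (Tpow k V n))

/-- The elementary tensor `f 0 ⊗ f 1 ⊗ ⋯ ⊗ f n` in `Tpow k V n`. -/
def tpow (k : Type) [Field k] (V : Type) [AddCommGroup V] [Module k V] :
    (n : ℕ) → (Fin (n + 1) → V) → Tpow k V n
  | 0, f => (f 0 : V)
  | n + 1, f => (f 0 ⊗ₜ[k] tpow k V n (fun i => f i.succ) : V ⊗[k] Tpow k V n)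

/-- The iterated comultiplication `Δ⁽ⁿ⁾ : H → H^{⊗(n+1)}`, `Δ⁽⁰⁾ = id`,
`Δ⁽ⁿ⁺¹⁾ = (1 ⊗ Δ⁽ⁿ⁾) ∘ Δ`. -/
def comulIter (k : Type) [Field k] (H : Type) [Ring H] [HopfAlgebra k H] :
    (n : ℕ) → H →ₗ[k] Tpow k H n
  | 0 => LinearMap.id
  | n + 1 =>
    (LinearMap.lTensor H (comulIter k H n) ∘ₗ Coalgebra.comul :
      H →ₗ[k] (H ⊗[k] Tpow k H n))

/-- A finite Sweedler-type representation `Δ⁽ⁿ⁾ h = ∑ᵢ h⁽¹⁾ᵢ ⊗ ⋯ ⊗ h⁽ⁿ⁺¹⁾ᵢ` of the iterated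
comultiplication of `h`; `leg i j` is the `(j+1)`-st Sweedler leg of the `i`-th summand. -/
structure IterRepr (k : Type) [Field k] (H : Type) [Ring H] [HopfAlgebra k H]
    (n : ℕ) (h : H) where
  ι : Type
  s : Finset ι
  leg : ι → Fin (n + 1) → H
  eq : ∑ i ∈ s, tpow k H n (leg i) = comulIter k H n h

/-- Merge an `(n+1)`-tuple to an `n`-tuple, replacing the two entries at positions `i, i+1`
by the single entry `v`. -/
def mergeAt {V : Type} {n : ℕ} (i : Fin n) (x : Fin (n + 1) → V) (v : V) :
    Fin n → V :=
  fun j => if (j : ℕ) < (i : ℕ) then x (Fin.castSucc j) else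
    if (j : ℕ) = (i : ℕ) then v else x j.succ

variable (k : Type) [Field k] (H : Type) [Ring H] [HopfAlgebra k H]

/-- `H` is cocommutative. -/
def Cocomm : Prop :=
  ∀ h : H, (TensorProduct.comm k H H) (Coalgebra.comul (R := k) h) = Coalgebra.comul (R := k) h

variable (A : Type) [Ring A] [Algebra k A]
variable (rho : H →ₗ[k] A →ₗ[k] A)

/-- `rho` is a weak action of `H` on `A`:
`h(ab) = h⁽¹⁾(a)h⁽²⁾(b)`, `h(1) = ε(h)1` and `1(a) = a`. -/
def IsWeakAction : Prop :=
  (∀ (h : H) (a b : A) (R : IterRepr k H 1 h),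
      rho h (a * b) = ∑ i ∈ R.s, rho (R.leg i 0) a * rho (R.leg i 1) b) ∧
  (∀ h : H, rho h (1 : A) = Coalgebra.counit (R := k) h • (1 : A)) ∧
  (∀ a : A, rho 1 a = a)

/-- `rho` makes `A` a left `H`-module algebra: a weak action which is an action. -/
def IsModuleAlgebraAction : Prop :=
  IsWeakAction k H A rho ∧ (∀ (h l : H) (a : A), rho (h * l) a = rho h (rho l a))

variable (sg : H →ₗ[k] H →ₗ[k] k)

/-- Normality for a `k`-valued cocycle: `σ(h,1) = σ(1,h) = ε(h)`. -/
def NormalK : Prop :=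
  ∀ h : H, sg h 1 = Coalgebra.counit (R := k) h ∧ sg 1 h = Coalgebra.counit (R := k) h

/-- The cocycle property for a `k`-valued cocycle:
`σ(l⁽¹⁾,m⁽¹⁾)σ(h,l⁽²⁾m⁽²⁾) = σ(h⁽¹⁾,l⁽¹⁾)σ(h⁽²⁾l⁽²⁾,m)`. -/
def CocycleK : Prop :=
  ∀ (h l m : H) (Rh : IterRepr k H 1 h) (Rl : IterRepr k H 1 l) (Rm : IterRepr k H 1 m),
    ∑ j ∈ Rl.s, ∑ c ∈ Rm.s,
        sg (Rl.leg j 0) (Rm.leg c 0) * sg h (Rl.leg j 1 * Rm.leg c 1) =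
      ∑ i ∈ Rh.s, ∑ j ∈ Rl.s,
        sg (Rh.leg i 0) (Rl.leg j 0) * sg (Rh.leg i 1 * Rl.leg j 1) m

/-- The twisted module property for a `k`-valued cocycle:
`h⁽¹⁾(l⁽¹⁾(a))σ(h⁽²⁾,l⁽²⁾) = σ(h⁽¹⁾,l⁽¹⁾)(h⁽²⁾l⁽²⁾)(a)`. -/
def TwistedModuleK : Prop :=
  ∀ (h l : H) (a : A) (Rh : IterRepr k H 1 h) (Rl : IterRepr k H 1 l),
    ∑ i ∈ Rh.s, ∑ j ∈ Rl.s,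
        sg (Rh.leg i 1) (Rl.leg j 1) • rho (Rh.leg i 0) (rho (Rl.leg j 0) a) =
      ∑ i ∈ Rh.s, ∑ j ∈ Rl.s,
        sg (Rh.leg i 0) (Rl.leg j 0) • rho (Rh.leg i 1 * Rl.leg j 1) a

/-- The `k`-valued map `σ`, viewed in the convolution algebra `Hom_k(H ⊗ H, A)` via
`x ⊗ y ↦ σ(x,y)1_A`, is convolution invertible. -/
def ConvInvertibleK : Prop :=
  ∃ sg' : H →ₗ[k] H →ₗ[k] A,
    ∀ (h l : H) (Rh : IterRepr k H 1 h) (Rl : IterRepr k H 1 l),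
      (∑ i ∈ Rh.s, ∑ j ∈ Rl.s,
          (sg (Rh.leg i 0) (Rl.leg j 0) • (1 : A)) * sg' (Rh.leg i 1) (Rl.leg j 1) =
        (Coalgebra.counit (R := k) h * Coalgebra.counit (R := k) l) • (1 : A)) ∧
      (∑ i ∈ Rh.s, ∑ j ∈ Rl.s,
          sg' (Rh.leg i 0) (Rl.leg j 0) * (sg (Rh.leg i 1) (Rl.leg j 1) • (1 : A)) =
        (Coalgebra.counit (R := k) h * Coalgebra.counit (R := k) l) • (1 : A))

/-- Normality, as an identity in `A`: `σ(h,1) = σ(1,h) = ε(h)1_A`. -/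
def NormalKA : Prop :=
  ∀ h : H, sg h 1 • (1 : A) = Coalgebra.counit (R := k) h • (1 : A) ∧
    sg 1 h • (1 : A) = Coalgebra.counit (R := k) h • (1 : A)

/-- The cocycle property, as an identity in `A` (values of `σ` lie in `k·1_A`):
`σ(l⁽¹⁾,m⁽¹⁾)σ(h,l⁽²⁾m⁽²⁾) = σ(h⁽¹⁾,l⁽¹⁾)σ(h⁽²⁾l⁽²⁾,m)`. -/
def CocycleKA : Prop :=
  ∀ (h l m : H) (Rh : IterRepr k H 1 h) (Rl : IterRepr k H 1 l) (Rm : IterRepr k H 1 m),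
    ∑ j ∈ Rl.s, ∑ c ∈ Rm.s,
        (sg (Rl.leg j 0) (Rm.leg c 0) * sg h (Rl.leg j 1 * Rm.leg c 1)) • (1 : A) =
      ∑ i ∈ Rh.s, ∑ j ∈ Rl.s,
        (sg (Rh.leg i 0) (Rl.leg j 0) * sg (Rh.leg i 1 * Rl.leg j 1) m) • (1 : A)

/-- The cocycle property of `σ` (values in `k·1_A`), written with the weak action, as in the
paper: `h⁽¹⁾(σ(l⁽¹⁾,m⁽¹⁾))σ(h⁽²⁾,l⁽²⁾m⁽²⁾) = σ(h⁽¹⁾,l⁽¹⁾)σ(h⁽²⁾l⁽²⁾,m)` in `A`. -/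
def CocycleWithActionK : Prop :=
  ∀ (h l m : H) (Rh : IterRepr k H 1 h) (Rl : IterRepr k H 1 l) (Rm : IterRepr k H 1 m),
    ∑ i ∈ Rh.s, ∑ j ∈ Rl.s, ∑ c ∈ Rm.s,
        rho (Rh.leg i 0) (sg (Rl.leg j 0) (Rm.leg c 0) • (1 : A)) *
          (sg (Rh.leg i 1) (Rl.leg j 1 * Rm.leg c 1) • (1 : A)) =
      ∑ i ∈ Rh.s, ∑ j ∈ Rl.s,
        (sg (Rh.leg i 0) (Rl.leg j 0) • (1 : A)) *
          (sg (Rh.leg i 1 * Rl.leg j 1) m • (1 : A))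

/-- The twisted module property of `σ` (values in `k·1_A`), as in the paper:
`h⁽¹⁾(l⁽¹⁾(a))σ(h⁽²⁾,l⁽²⁾) = σ(h⁽¹⁾,l⁽¹⁾)(h⁽²⁾l⁽²⁾)(a)` in `A`. -/
def TwistedModuleWithActionK : Prop :=
  ∀ (h l : H) (a : A) (Rh : IterRepr k H 1 h) (Rl : IterRepr k H 1 l),
    ∑ i ∈ Rh.s, ∑ j ∈ Rl.s,
        rho (Rh.leg i 0) (rho (Rl.leg j 0) a) * (sg (Rh.leg i 1) (Rl.leg j 1) • (1 : A)) =
      ∑ i ∈ Rh.s, ∑ j ∈ Rl.s,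
        (sg (Rh.leg i 0) (Rl.leg j 0) • (1 : A)) * rho (Rh.leg i 1 * Rl.leg j 1) a

/-- The Sweedler representation of `Δ(h)` with two legs attached to a `Coalgebra.Repr`. -/
def iterReprOfRepr {ι : Type} {h : H} (R : Coalgebra.Repr k h ι) : IterRepr k H 1 h where
  ι := ι
  s := R.index
  leg i := ![R.left i, R.right i]
  eq := by
    have key : comulIter k H 1 h = (Coalgebra.comul (R := k) h : H ⊗[k] H) :=
      LinearMap.congr_fun (LinearMap.lTensor_id (R := k) H H) (Coalgebra.comul (R := k) h)
    exact R.eq.trans key.symm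

/-- The convolution product of two maps on `H ⊗ H`, evaluated at a pure tensor. -/
lemma convMul_tmul_apply {ι κ : Type} {h l : H}
    (Rh : Coalgebra.Repr k h ι) (Rl : Coalgebra.Repr k l κ)
    (f g : WithConv (H ⊗[k] H →ₗ[k] A)) :
    (f * g) (h ⊗ₜ[k] l) = ∑ i ∈ Rh.index, ∑ j ∈ Rl.index,
      f (Rh.left i ⊗ₜ[k] Rl.left j) * g (Rh.right i ⊗ₜ[k] Rl.right j) := by
  simp [TensorProduct.comul_tmul, ← Rh.eq, ← Rl.eq, TensorProduct.sum_tmul,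
    TensorProduct.tmul_sum]
  rw [Finset.sum_comm]

/-- Over a cocommutative coalgebra, scalar-valued maps are central for convolution. -/
lemma convMul_algebraMap_comm {C : Type} [AddCommGroup C] [Module k C] [Coalgebra k C]
    [Coalgebra.IsCocomm k C] (s : C →ₗ[k] k) (f : WithConv (C →ₗ[k] A)) :
    WithConv.toConv (Algebra.linearMap k A ∘ₗ s) * f =
      f * WithConv.toConv (Algebra.linearMap k A ∘ₗ s) := by
  ext x
  rw [LinearMap.convMul_apply, ← Coalgebra.comm_comul k x, LinearMap.convMul_apply]
  induction Coalgebra.comul (R := k) x using TensorProduct.induction_on with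
  | zero => simp
  | tmul a b => simp [Algebra.commutes]
  | add a b ha hb => simp only [map_add, ha, hb]

/-- If `H` is cocommutative and `σ : H ⊗ H → k·1_A` is a convolution
invertible normal cocycle satisfying the twisted module property for a weak action of `H`
on `A`, then the weak action is an action: `h(l(a)) = (hl)(a)`; in particular `A` is an
`H`-module algebra. -/
theorem weakAction_isAction_of_scalar_cocycle
    (k : Type) [Field k] (H : Type) [Ring H] [HopfAlgebra k H]
    (A : Type) [Ring A] [Algebra k A]
    (rho : H →ₗ[k] A →ₗ[k] A) (sg : H →ₗ[k] H →ₗ[k] k)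
    (hco : Cocomm k H)
    (hwa : IsWeakAction k H A rho)
    (hnorm : NormalKA k H A sg)
    (hcoc : CocycleWithActionK k H A rho sg)
    (htw : TwistedModuleWithActionK k H A rho sg)
    (hinv : ConvInvertibleK k H A sg) :
    ∀ (h l : H) (a : A), rho h (rho l a) = rho (h * l) a := by
  have : Coalgebra.IsCocomm k H := ⟨LinearMap.ext hco⟩
  obtain ⟨sg', hsg'⟩ := hinv
  intro h l a
  let σ : WithConv (H ⊗[k] H →ₗ[k] A) :=
    WithConv.toConv (Algebra.linearMap k A ∘ₗ TensorProduct.lift sg)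
  let τ : WithConv (H ⊗[k] H →ₗ[k] A) := WithConv.toConv (TensorProduct.lift sg')
  let F : WithConv (H ⊗[k] H →ₗ[k] A) :=
    WithConv.toConv (TensorProduct.lift (rho.compl₂ (rho.flip a)))
  let G : WithConv (H ⊗[k] H →ₗ[k] A) :=
    WithConv.toConv (rho.flip a ∘ₗ LinearMap.mul' k H)
  have hστ : σ * τ = 1 := by
    apply WithConv.ofConv_injective
    ext x y
    have := (hsg' x y (iterReprOfRepr k H (Coalgebra.Repr.arbitrary k x))
      (iterReprOfRepr k H (Coalgebra.Repr.arbitrary k y))).1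
    refine (convMul_tmul_apply k H A (Coalgebra.Repr.arbitrary k x)
      (Coalgebra.Repr.arbitrary k y) σ τ).trans ?_
    simpa [σ, τ, iterReprOfRepr, Algebra.smul_def,
      mul_comm (Coalgebra.counit (R := k) x)] using this
  have hFG : F * σ = σ * G := by
    apply WithConv.ofConv_injective
    ext x y
    have := htw x y a (iterReprOfRepr k H (Coalgebra.Repr.arbitrary k x))
      (iterReprOfRepr k H (Coalgebra.Repr.arbitrary k y))
    refine (convMul_tmul_apply k H A (Coalgebra.Repr.arbitrary k x)
      (Coalgebra.Repr.arbitrary k y) F σ).trans (Eq.trans ?_ (convMul_tmul_apply k H A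
      (Coalgebra.Repr.arbitrary k x) (Coalgebra.Repr.arbitrary k y) σ G).symm)
    simpa [σ, F, G, iterReprOfRepr, Algebra.smul_def] using this
  have hF : F = G :=
    calc F = F * σ * τ := by rw [mul_assoc, hστ, mul_one]
      _ = G * σ * τ := by rw [hFG, convMul_algebraMap_comm]
      _ = G := by rw [mul_assoc, hστ, mul_one]
  simpa [F, G] using congrArg (fun f => f (h ⊗ₜ[k] l)) hF
end
end

section
/- Let H be a cocommutative Hopf algebra over a field k, let A be a unital k-algebra equipped with a weak action of H, and let σ : H⊗H → A be a convolution invertible map taking values in the center of A which satisfies the normality, cocycle and twisted module properties. Then the weak action is an action, i.e. h(l(a)) = (hl)(a) for all h,l ∈ H and a ∈ A. -/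
open TensorProduct

noncomputable section

variable (k : Type) [Field k] (H : Type) [Ring H] [HopfAlgebra k H]

variable (A : Type) [Ring A] [Algebra k A]
variable (rho : H →ₗ[k] A →ₗ[k] A)

variable (sg : H →ₗ[k] H →ₗ[k] k)

variable (sgA : H →ₗ[k] H →ₗ[k] A)

/-- Normality for an `A`-valued cocycle: `σ(h,1) = σ(1,h) = ε(h)1`. -/
def NormalA : Prop :=
  ∀ h : H, sgA h 1 = Coalgebra.counit (R := k) h • (1 : A) ∧
    sgA 1 h = Coalgebra.counit (R := k) h • (1 : A)

/-- The cocycle property for an `A`-valued cocycle: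
`h⁽¹⁾(σ(l⁽¹⁾,m⁽¹⁾))σ(h⁽²⁾,l⁽²⁾m⁽²⁾) = σ(h⁽¹⁾,l⁽¹⁾)σ(h⁽²⁾l⁽²⁾,m)`. -/
def CocycleA : Prop :=
  ∀ (h l m : H) (Rh : IterRepr k H 1 h) (Rl : IterRepr k H 1 l) (Rm : IterRepr k H 1 m),
    ∑ i ∈ Rh.s, ∑ j ∈ Rl.s, ∑ c ∈ Rm.s,
        rho (Rh.leg i 0) (sgA (Rl.leg j 0) (Rm.leg c 0)) *
          sgA (Rh.leg i 1) (Rl.leg j 1 * Rm.leg c 1) =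
      ∑ i ∈ Rh.s, ∑ j ∈ Rl.s,
        sgA (Rh.leg i 0) (Rl.leg j 0) * sgA (Rh.leg i 1 * Rl.leg j 1) m

/-- The twisted module property for an `A`-valued cocycle:
`h⁽¹⁾(l⁽¹⁾(a))σ(h⁽²⁾,l⁽²⁾) = σ(h⁽¹⁾,l⁽¹⁾)(h⁽²⁾l⁽²⁾)(a)`. -/
def TwistedModuleA : Prop :=
  ∀ (h l : H) (a : A) (Rh : IterRepr k H 1 h) (Rl : IterRepr k H 1 l),
    ∑ i ∈ Rh.s, ∑ j ∈ Rl.s,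
        rho (Rh.leg i 0) (rho (Rl.leg j 0) a) * sgA (Rh.leg i 1) (Rl.leg j 1) =
      ∑ i ∈ Rh.s, ∑ j ∈ Rl.s,
        sgA (Rh.leg i 0) (Rl.leg j 0) * rho (Rh.leg i 1 * Rl.leg j 1) a

/-- `σ` is convolution invertible in `Hom_k(H ⊗ H, A)`. -/
def ConvInvertibleA : Prop :=
  ∃ sg' : H →ₗ[k] H →ₗ[k] A,
    ∀ (h l : H) (Rh : IterRepr k H 1 h) (Rl : IterRepr k H 1 l),
      (∑ i ∈ Rh.s, ∑ j ∈ Rl.s,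
          sgA (Rh.leg i 0) (Rl.leg j 0) * sg' (Rh.leg i 1) (Rl.leg j 1) =
        (Coalgebra.counit (R := k) h * Coalgebra.counit (R := k) l) • (1 : A)) ∧
      (∑ i ∈ Rh.s, ∑ j ∈ Rl.s,
          sg' (Rh.leg i 0) (Rl.leg j 0) * sgA (Rh.leg i 1) (Rl.leg j 1) =
        (Coalgebra.counit (R := k) h * Coalgebra.counit (R := k) l) • (1 : A))

section

variable {k H}

lemma IterRepr.sum_tmul {h : H} (R : IterRepr k H 1 h) :
    ∑ i ∈ R.s, R.leg i 0 ⊗ₜ[k] R.leg i 1 = Coalgebra.comul (R := k) h := by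
  have e : (LinearMap.lTensor H (comulIter k H 0)) (Coalgebra.comul (R := k) h) =
      Coalgebra.comul (R := k) h := LinearMap.congr_fun (LinearMap.lTensor_id H H) _
  exact R.eq.trans e

/-- The Sweedler representation attached to an expression of `Δ h` as a sum of pure tensors. -/
def IterRepr.ofSum {h : H} {ι : Type} (s : Finset ι) (x y : ι → H)
    (e : ∑ i ∈ s, x i ⊗ₜ[k] y i = Coalgebra.comul (R := k) h) : IterRepr k H 1 h where
  ι := ι
  s := s
  leg i := ![x i, y i]
  eq := e.trans (LinearMap.congr_fun (LinearMap.lTensor_id H H) _).symm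

lemma IterRepr.nonempty (h : H) : Nonempty (IterRepr k H 1 h) :=
  let R := Coalgebra.Repr.arbitrary k h
  ⟨IterRepr.ofSum R.index R.left R.right R.eq⟩

/-- For cocommutative `H`, interchanging the two Sweedler legs gives another representation. -/
def IterRepr.swap (hco : Cocomm k H) {h : H} (R : IterRepr k H 1 h) : IterRepr k H 1 h :=
  IterRepr.ofSum R.s (fun i => R.leg i 1) (fun i => R.leg i 0) <| by
    rw [← hco h, ← R.sum_tmul, map_sum]
    rfl

lemma convMul_tmul_eq_sum {A : Type} [Ring A] [Algebra k A]
    (F G : WithConv (H ⊗[k] H →ₗ[k] A)) {h l : H}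
    (Rh : IterRepr k H 1 h) (Rl : IterRepr k H 1 l) :
    (F * G) (h ⊗ₜ[k] l) = ∑ i ∈ Rh.s, ∑ j ∈ Rl.s,
      F (Rh.leg i 0 ⊗ₜ[k] Rl.leg j 0) * G (Rh.leg i 1 ⊗ₜ[k] Rl.leg j 1) := by
  rw [LinearMap.convMul_apply, TensorProduct.comul_tmul, ← Rh.sum_tmul, ← Rl.sum_tmul]
  simp [TensorProduct.sum_tmul, TensorProduct.tmul_sum]
  exact Finset.sum_comm

lemma convMul_comm_of_central (hco : Cocomm k H) {A : Type} [Ring A] [Algebra k A]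
    (S G : WithConv (H ⊗[k] H →ₗ[k] A))
    (hS : ∀ h l : H, S (h ⊗ₜ[k] l) ∈ Set.center A) : S * G = G * S := by
  apply WithConv.ofConv_injective
  refine TensorProduct.ext' fun h l => ?_
  obtain ⟨Rh⟩ := IterRepr.nonempty (k := k) h
  obtain ⟨Rl⟩ := IterRepr.nonempty (k := k) l
  refine (convMul_tmul_eq_sum S G Rh Rl).trans
    (Eq.trans ?_ (convMul_tmul_eq_sum G S (Rh.swap hco) (Rl.swap hco)).symm)
  exact Finset.sum_congr rfl fun i _ => Finset.sum_congr rfl fun j _ => ((hS _ _).comm _).eq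

end

/-- If `H` is cocommutative and `σ : H ⊗ H → A` is a convolution invertible
normal cocycle with values in the center of `A`, satisfying the twisted module property for a
weak action of `H` on `A`, then the weak action is an action: `h(l(a)) = (hl)(a)`. -/
theorem weakAction_isAction_of_central_cocycle
    (k : Type) [Field k] (H : Type) [Ring H] [HopfAlgebra k H]
    (A : Type) [Ring A] [Algebra k A]
    (rho : H →ₗ[k] A →ₗ[k] A) (sgA : H →ₗ[k] H →ₗ[k] A)
    (hco : Cocomm k H)
    (hwa : IsWeakAction k H A rho)
    (hcentral : ∀ h l : H, sgA h l ∈ Set.center A)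
    (hnorm : NormalA k H A sgA)
    (hcoc : CocycleA k H A rho sgA)
    (htw : TwistedModuleA k H A rho sgA)
    (hinv : ConvInvertibleA k H A sgA) :
    ∀ (h l : H) (a : A), rho h (rho l a) = rho (h * l) a := by
  obtain ⟨sg', hsg'⟩ := hinv
  intro h l a
  let F : WithConv (H ⊗[k] H →ₗ[k] A) :=
    WithConv.toConv (TensorProduct.lift (rho.compl₂ (rho.flip a)))
  let G : WithConv (H ⊗[k] H →ₗ[k] A) :=
    WithConv.toConv (rho.flip a ∘ₗ LinearMap.mul' k H)
  let S : WithConv (H ⊗[k] H →ₗ[k] A) := WithConv.toConv (TensorProduct.lift sgA)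
  let S' : WithConv (H ⊗[k] H →ₗ[k] A) := WithConv.toConv (TensorProduct.lift sg')
  have twisted : F * S = S * G := by
    apply WithConv.ofConv_injective
    refine TensorProduct.ext' fun h l => ?_
    obtain ⟨Rh⟩ := IterRepr.nonempty (k := k) h
    obtain ⟨Rl⟩ := IterRepr.nonempty (k := k) l
    exact (convMul_tmul_eq_sum F S Rh Rl).trans
      ((htw h l a Rh Rl).trans (convMul_tmul_eq_sum S G Rh Rl).symm)
  have inverse : S * S' = 1 := by
    apply WithConv.ofConv_injective
    refine TensorProduct.ext' fun h l => ?_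
    obtain ⟨Rh⟩ := IterRepr.nonempty (k := k) h
    obtain ⟨Rl⟩ := IterRepr.nonempty (k := k) l
    refine (convMul_tmul_eq_sum S S' Rh Rl).trans ((hsg' h l Rh Rl).1.trans ?_)
    change _ = (1 : WithConv (H ⊗[k] H →ₗ[k] A)) (h ⊗ₜ[k] l)
    rw [LinearMap.convOne_apply, TensorProduct.counit_tmul, Algebra.algebraMap_eq_smul_one,
      smul_eq_mul, mul_comm]
  have key : F = G := by
    rw [← mul_one F, ← inverse, ← mul_assoc, twisted,
      convMul_comm_of_central hco S G hcentral, mul_assoc, inverse, mul_one]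
  exact congrArg (fun f : WithConv (H ⊗[k] H →ₗ[k] A) => f (h ⊗ₜ[k] l)) key
end
end

section
/- Let H be a Hopf algebra over a field k, let A be a unital k-algebra with a weak action of H, and let σ : H⊗H → A be a k-linear map. Define a multiplication on the vector space A⊗H by (a⊗h)(b⊗l) = a h⁽¹⁾(b) σ(h⁽²⁾,l⁽¹⁾) ⊗ h⁽³⁾l⁽²⁾. This multiplication is associative with unit 1⊗1 if and only if σ and the weak action satisfy the normality, cocycle and twisted module properties. -/
open TensorProduct

noncomputable section

variable (k : Type) [Field k] (H : Type) [Ring H] [HopfAlgebra k H]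

variable (A : Type) [Ring A] [Algebra k A]
variable (rho : H →ₗ[k] A →ₗ[k] A)

variable (sg : H →ₗ[k] H →ₗ[k] k)

variable (sgA : H →ₗ[k] H →ₗ[k] A)

/-- Spec of the multiplication on `A ⊗ H` determined by the weak action `rho` and the
`A`-valued map `σ`: `(a ⊗ h)(b ⊗ l) = a h⁽¹⁾(b) σ(h⁽²⁾,l⁽¹⁾) ⊗ h⁽³⁾l⁽²⁾`. -/
def IsCrossedMulA (mul : (A ⊗[k] H) →ₗ[k] (A ⊗[k] H) →ₗ[k] (A ⊗[k] H)) : Prop :=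
  ∀ (a b : A) (h l : H) (R : IterRepr k H 2 h) (S : IterRepr k H 1 l),
    mul (a ⊗ₜ[k] h) (b ⊗ₜ[k] l) =
      ∑ i ∈ R.s, ∑ j ∈ S.s,
        (a * rho (R.leg i 0) b * sgA (R.leg i 1) (S.leg j 0)) ⊗ₜ[k]
          (R.leg i 2 * S.leg j 1)

namespace CrossedProduct

open Coalgebra WithConv

section Convolution

variable {k} {H} {A}
variable {B C D E : Type} [AddCommGroup B] [Module k B] [AddCommGroup C] [Module k C]
  [Coalgebra k C] [AddCommGroup D] [Module k D] [Coalgebra k D] [AddCommGroup E] [Module k E]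
  [Coalgebra k E]

/-- Precomposition of an element of a convolution algebra with a coalgebra morphism. -/
def pull (p : C →ₗc[k] D) (f : WithConv (D →ₗ[k] A)) : WithConv (C →ₗ[k] A) :=
  toConv (f.ofConv ∘ₗ (p : C →ₗ[k] D))

@[simp] lemma pull_apply (p : C →ₗc[k] D) (f : WithConv (D →ₗ[k] A)) (x : C) :
    pull p f x = f (p x) := rfl

lemma pull_mul (p : C →ₗc[k] D) (f g : WithConv (D →ₗ[k] A)) :
    pull p (f * g) = pull p f * pull p g :=
  congrArg toConv (LinearMap.convMul_comp_coalgHom_distrib f g p)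

/-- The convolution algebra element `x ↦ ε(x) a`. -/
def cst (C : Type) [AddCommGroup C] [Module k C] [Coalgebra k C] (a : A) :
    WithConv (C →ₗ[k] A) :=
  toConv (LinearMap.toSpanSingleton k A a ∘ₗ counit)

@[simp] lemma cst_apply (a : A) (x : C) :
    cst (k := k) C a x = counit (R := k) x • a := rfl

lemma cst_one : cst (k := k) C (1 : A) = 1 := by
  ext x
  simp [Algebra.algebraMap_eq_smul_one]

@[simp] lemma pull_cst (p : C →ₗc[k] D) (a : A) : pull p (cst D a) = cst C a := by
  ext x
  simp

lemma coalgHom_tensor_ext {p q : C ⊗[k] D →ₗc[k] E} (h : ∀ x y, p (x ⊗ₜ y) = q (x ⊗ₜ y)) :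
    p = q :=
  CoalgHom.coe_linearMap_injective (TensorProduct.ext' h)

/-- The coalgebra morphism `x ⊗ y ↦ ε(y) x`. -/
def prLeft (C D : Type) [AddCommGroup C] [Module k C] [Coalgebra k C] [AddCommGroup D]
    [Module k D] [Coalgebra k D] : C ⊗[k] D →ₗc[k] C :=
  (Coalgebra.TensorProduct.rid k k C : C ⊗[k] k →ₗc[k] C).comp
    (Coalgebra.TensorProduct.map (CoalgHom.id k C) (counitCoalgHom k D))

@[simp] lemma prLeft_tmul (x : C) (y : D) :
    prLeft (k := k) C D (x ⊗ₜ y) = counit (R := k) y • x := rfl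

/-- Representations of the comultiplications of `x` and `y` yield one for `x ⊗ y`. -/
def reprTmul {ι κ : Type} {x : C} {y : D} (R : Coalgebra.Repr k x ι) (S : Coalgebra.Repr k y κ) :
    Coalgebra.Repr k (x ⊗ₜ[k] y) (ι × κ) where
  index := R.index ×ˢ S.index
  left i := R.left i.1 ⊗ₜ S.left i.2
  right i := R.right i.1 ⊗ₜ S.right i.2
  eq := by
    simp [← R.eq, ← S.eq, TensorProduct.sum_tmul R.index, TensorProduct.tmul_sum,
      ← Finset.sum_product']

lemma convMul_tmul {ι κ : Type} (f g : WithConv (C ⊗[k] D →ₗ[k] A)) {x : C} {y : D}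
    (R : Coalgebra.Repr k x ι) (S : Coalgebra.Repr k y κ) :
    (f * g) (x ⊗ₜ y) = ∑ i ∈ R.index, ∑ j ∈ S.index,
      f (R.left i ⊗ₜ S.left j) * g (R.right i ⊗ₜ S.right j) := by
  rw [(reprTmul R S).convMul_apply]
  exact Finset.sum_product _ _ _

lemma pull_prLeft_mul_tmul {ι : Type} (f : WithConv (C →ₗ[k] A))
    (g : WithConv (C ⊗[k] D →ₗ[k] A)) {x : C} (R : Coalgebra.Repr k x ι) (y : D) :
    (pull (prLeft C D) f * g) (x ⊗ₜ y) =
      ∑ i ∈ R.index, f (R.left i) * g (R.right i ⊗ₜ y) := by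
  rw [convMul_tmul _ _ R (ℛ k y)]
  refine Finset.sum_congr rfl fun i _ => ?_
  conv_rhs => rw [← sum_counit_smul (ℛ k y)]
  simp [TensorProduct.tmul_sum, Finset.mul_sum]

/-- The map `x ↦ f(x⁽¹⁾) ⊗ p(x⁽²⁾)`. -/
def spread (f : WithConv (C →ₗ[k] A)) (p : C →ₗc[k] D) : C →ₗ[k] A ⊗[k] D :=
  TensorProduct.map f.ofConv p ∘ₗ comul

lemma spread_apply {ι : Type} (f : WithConv (C →ₗ[k] A)) (p : C →ₗc[k] D) {x : C}
    (R : Coalgebra.Repr k x ι) :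
    spread f p x = ∑ i ∈ R.index, f (R.left i) ⊗ₜ p (R.right i) := by
  simp [spread, ← R.eq]

lemma spread_coalgHom_apply (f : WithConv (D →ₗ[k] A)) (q : D →ₗc[k] E) (p : C →ₗc[k] D)
    (x : C) : spread f q (p x) = spread (pull p f) (q.comp p) x := by
  rw [spread_apply f q ((ℛ k x).induced p), spread_apply _ _ (ℛ k x)]
  rfl

lemma rid_counit_spread (f : WithConv (C →ₗ[k] A)) (p : C →ₗc[k] D) (x : C) :
    TensorProduct.rid k A (LinearMap.lTensor A counit (spread f p x)) = f x := by
  rw [spread_apply f p (ℛ k x)]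
  simp

lemma spread_injective (p : C →ₗc[k] D) {f g : WithConv (C →ₗ[k] A)}
    (h : spread f p = spread g p) : f = g := by
  ext x
  rw [← rid_counit_spread f p, ← rid_counit_spread g p, h]

lemma spread_cst_id (a : A) (x : C) : spread (cst C a) (CoalgHom.id k C) x = a ⊗ₜ x := by
  rw [spread_apply _ _ (ℛ k x)]
  conv_rhs => rw [← sum_counit_smul (ℛ k x)]
  simp [TensorProduct.tmul_sum, TensorProduct.smul_tmul]

lemma spread_mul (f g : WithConv (C →ₗ[k] A)) (p : C →ₗc[k] H) {ι : Type} {x : C}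
    (R : Coalgebra.Repr k x ι) :
    spread (f * g) p x =
      ∑ i ∈ R.index, (f (R.left i) ⊗ₜ[k] (1 : H)) * spread g p (R.right i) := by
  let i₁ : A →ₐ[k] A ⊗[k] H := Algebra.TensorProduct.includeLeft
  let j : WithConv (C →ₗ[k] A) → WithConv (C →ₗ[k] A ⊗[k] H) :=
    fun f => toConv (i₁.toLinearMap ∘ₗ f.ofConv)
  have hj : ∀ f g, j (f * g) = j f * j g := fun f g =>
    congrArg toConv (LinearMap.algHom_comp_convMul_distrib i₁ f g)
  let r : WithConv (C →ₗ[k] A ⊗[k] H) :=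
    toConv (Algebra.TensorProduct.includeRight.toLinearMap ∘ₗ (p : C →ₗ[k] H))
  have hs : ∀ f : WithConv (C →ₗ[k] A), toConv (spread f p) = j f * r := by
    intro f
    ext x
    change spread f p x = (j f * r) x
    rw [(ℛ k x).convMul_apply, spread_apply _ _ (ℛ k x)]
    simp [j, r, i₁]
  have h : spread (f * g) p x = (j f * toConv (spread g p)) x := by
    rw [hs, ← mul_assoc, ← hj, ← hs]
  rw [h, R.convMul_apply]
  simp [j, i₁]

lemma spread_prLeft_mul (f : WithConv (C →ₗ[k] A)) (g : WithConv (C ⊗[k] D →ₗ[k] A))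
    (p : C ⊗[k] D →ₗc[k] H) {ι : Type} {x : C} (R : Coalgebra.Repr k x ι) (y : D) :
    spread (pull (prLeft C D) f * g) p (x ⊗ₜ y) =
      ∑ i ∈ R.index, (f (R.left i) ⊗ₜ[k] (1 : H)) * spread g p (R.right i ⊗ₜ y) := by
  rw [spread_mul _ _ _ (reprTmul R (ℛ k y))]
  refine (Finset.sum_product _ _ _).trans (Finset.sum_congr rfl fun i _ => ?_)
  conv_rhs => rw [← sum_counit_smul (ℛ k y)]
  simp [reprTmul, TensorProduct.tmul_sum, Finset.mul_sum, ← TensorProduct.smul_tmul']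

end Convolution

section Sweedler

variable {k} {H}

/-- The representation of `Δ h` underlying a Sweedler representation of `Δ⁽¹⁾ h`. -/
def reprOfIterRepr {h : H} (R : IterRepr k H 1 h) : Coalgebra.Repr k h R.ι where
  index := R.s
  left i := R.leg i 0
  right i := R.leg i 1
  eq := by
    have h' := R.eq
    have hid : LinearMap.lTensor H (LinearMap.id : H →ₗ[k] H) (comul h) = comul h := by simp
    exact h'.trans hid

/-- The Sweedler representation of `Δ⁽¹⁾ h` given by a representation of `Δ h`. -/
def iterReprOne {ι : Type} {h : H} (R : Coalgebra.Repr k h ι) : IterRepr k H 1 h where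
  ι := ι
  s := R.index
  leg i := ![R.left i, R.right i]
  eq := by
    have hid : LinearMap.lTensor H (LinearMap.id : H →ₗ[k] H) (comul h) = comul h := by simp
    exact R.eq.trans hid.symm

/-- The Sweedler representation of `Δ⁽²⁾ h` obtained by expanding the second leg of `Δ h`. -/
def iterReprTwo {ι κ : Type} {h : H} (R : Coalgebra.Repr k h ι)
    (S : (i : ι) → Coalgebra.Repr k (R.right i) κ) : IterRepr k H 2 h where
  ι := Σ _ : ι, κ
  s := R.index.sigma fun i => (S i).index
  leg i := ![R.left i.1, (S i.1).left i.2, (S i.1).right i.2]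
  eq := by
    have h1 : ∀ x : H, comulIter k H 1 x = comul (R := k) x := fun x => by
      change LinearMap.lTensor H (LinearMap.id : H →ₗ[k] H) (comul x) = comul x
      simp
    have h2 : comulIter k H 2 h = LinearMap.lTensor H (comulIter k H 1) (comul h) := rfl
    rw [h2, ← R.eq, map_sum, Finset.sum_sigma]
    refine Finset.sum_congr rfl fun i _ => ?_
    rw [LinearMap.lTensor_tmul, h1, ← (S i).eq]
    exact (TensorProduct.tmul_sum (R := k) (R.left i) (S i).index
      fun j => (S i).left j ⊗ₜ[k] (S i).right j).symm

end Sweedler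

section Crossed

variable {k} {H} {A}
variable {rho : H →ₗ[k] A →ₗ[k] A} {sgA : H →ₗ[k] H →ₗ[k] A}
variable {C D : Type} [AddCommGroup C] [Module k C]
  [Coalgebra k C] [AddCommGroup D] [Module k D]

/-- The map `x ⊗ y ↦ p(x)(g(y))`. -/
def act (rho : H →ₗ[k] A →ₗ[k] A) (p : C →ₗc[k] H) (g : WithConv (D →ₗ[k] A)) :
    WithConv (C ⊗[k] D →ₗ[k] A) :=
  toConv (TensorProduct.lift rho ∘ₗ TensorProduct.map (p : C →ₗ[k] H) g.ofConv)

@[simp] lemma act_tmul (p : C →ₗc[k] H) (g : WithConv (D →ₗ[k] A)) (x : C) (y : D) :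
    act rho p g (x ⊗ₜ y) = rho (p x) (g y) := rfl

variable [Coalgebra k D]

lemma act_mul (hwa : IsWeakAction k H A rho) (p : C →ₗc[k] H) (f g : WithConv (D →ₗ[k] A)) :
    act rho p (f * g) = act rho p f * act rho p g := by
  ext x y
  change rho (p x) ((f * g) y) = (act rho p f * act rho p g) (x ⊗ₜ y)
  rw [convMul_tmul _ _ (ℛ k x) (ℛ k y), (ℛ k y).convMul_apply, map_sum, Finset.sum_comm]
  exact Finset.sum_congr rfl fun j _ => hwa.1 _ _ _ (iterReprOne ((ℛ k x).induced p))

lemma act_one (hwa : IsWeakAction k H A rho) (p : C →ₗc[k] H) :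
    act rho p (1 : WithConv (D →ₗ[k] A)) = 1 := by
  ext x y
  change rho (p x) (algebraMap k A (counit (R := k) y)) =
    algebraMap k A (counit (R := k) (x ⊗ₜ[k] y))
  simp [hwa.2.1, Algebra.algebraMap_eq_smul_one, smul_smul]

/-- The map `x ⊗ y ↦ p(x) q(y)`. -/
def mulHom (p : C →ₗc[k] H) (q : D →ₗc[k] H) : C ⊗[k] D →ₗc[k] H :=
  (Bialgebra.mulCoalgHom k H).comp (Coalgebra.TensorProduct.map p q)

@[simp] lemma mulHom_tmul (p : C →ₗc[k] H) (q : D →ₗc[k] H) (x : C) (y : D) :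
    mulHom p q (x ⊗ₜ y) = p x * q y := rfl

/-- The map `x ⊗ y ↦ σ(p(x), q(y))`. -/
def cocyc (sgA : H →ₗ[k] H →ₗ[k] A) (p : C →ₗc[k] H) (q : D →ₗc[k] H) :
    WithConv (C ⊗[k] D →ₗ[k] A) :=
  pull (Coalgebra.TensorProduct.map p q) (toConv (TensorProduct.lift sgA))

@[simp] lemma cocyc_tmul (p : C →ₗc[k] H) (q : D →ₗc[k] H) (x : C) (y : D) :
    cocyc sgA p q (x ⊗ₜ y) = sgA (p x) (q y) := rfl

/-- The `A`-component of the crossed product of `f(x⁽¹⁾) ⊗ p(x⁽²⁾)` and `g(y⁽¹⁾) ⊗ q(y⁽²⁾)`. -/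
def crossed (rho : H →ₗ[k] A →ₗ[k] A) (sgA : H →ₗ[k] H →ₗ[k] A)
    (f : WithConv (C →ₗ[k] A)) (p : C →ₗc[k] H) (g : WithConv (D →ₗ[k] A)) (q : D →ₗc[k] H) :
    WithConv (C ⊗[k] D →ₗ[k] A) :=
  pull (prLeft C D) f * (act rho p g * cocyc sgA p q)

variable {mul : (A ⊗[k] H) →ₗ[k] (A ⊗[k] H) →ₗ[k] (A ⊗[k] H)}

lemma mul_tmul_tmul (hmul : IsCrossedMulA k H A rho sgA mul) {ι : Type} (a b : A) {h : H} (l : H)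
    (R : Coalgebra.Repr k h ι) :
    mul (a ⊗ₜ h) (b ⊗ₜ l) = ∑ i ∈ R.index, ((a * rho (R.left i) b) ⊗ₜ[k] (1 : H)) *
      spread (cocyc sgA (CoalgHom.id k H) (CoalgHom.id k H))
        (mulHom (CoalgHom.id k H) (CoalgHom.id k H)) (R.right i ⊗ₜ l) := by
  rw [hmul a b h l (iterReprTwo R fun i => ℛ k (R.right i)) (iterReprOne (ℛ k l))]
  refine (Finset.sum_sigma _ _ _).trans (Finset.sum_congr rfl fun i _ => ?_)
  rw [spread_apply _ _ (reprTmul (ℛ k (R.right i)) (ℛ k l)), Finset.mul_sum]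
  refine Eq.trans ?_ (Finset.sum_product _ _ _).symm
  refine Finset.sum_congr rfl fun j _ => Finset.sum_congr rfl fun c _ => ?_
  simp [iterReprTwo, iterReprOne, reprTmul]

lemma spread_cocyc_tmul (p : C →ₗc[k] H) (q : D →ₗc[k] H) (x : C) (y : D) :
    spread (cocyc sgA (CoalgHom.id k H) (CoalgHom.id k H))
        (mulHom (CoalgHom.id k H) (CoalgHom.id k H)) (p x ⊗ₜ q y) =
      spread (cocyc sgA p q) (mulHom p q) (x ⊗ₜ y) := by
  have h₁ : pull (Coalgebra.TensorProduct.map p q)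
      (cocyc sgA (CoalgHom.id k H) (CoalgHom.id k H)) = cocyc sgA p q := by
    ext x y
    rfl
  have h₂ : (mulHom (CoalgHom.id k H) (CoalgHom.id k H)).comp
      (Coalgebra.TensorProduct.map p q) = mulHom p q := coalgHom_tensor_ext fun _ _ => rfl
  rw [← h₁, ← h₂]
  exact spread_coalgHom_apply _ _ (Coalgebra.TensorProduct.map p q) (x ⊗ₜ y)

lemma mul_spread_spread (hmul : IsCrossedMulA k H A rho sgA mul) (f : WithConv (C →ₗ[k] A))
    (p : C →ₗc[k] H) (g : WithConv (D →ₗ[k] A)) (q : D →ₗc[k] H) (x : C) (y : D) :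
    mul (spread f p x) (spread g q y) =
      spread (crossed rho sgA f p g q) (mulHom p q) (x ⊗ₜ y) := by
  rw [spread_apply f p (ℛ k x), map_sum, LinearMap.sum_apply, spread_apply g q (ℛ k y), crossed,
    spread_prLeft_mul _ _ _ (ℛ k x)]
  refine Finset.sum_congr rfl fun i _ => ?_
  rw [map_sum, spread_mul _ _ _ (reprTmul (ℛ k ((ℛ k x).right i)) (ℛ k y)), Finset.mul_sum]
  refine Eq.trans ?_ (Finset.sum_product_right _ _ _).symm
  refine Finset.sum_congr rfl fun j _ => ?_
  rw [mul_tmul_tmul hmul _ _ _ ((ℛ k ((ℛ k x).right i)).induced p)]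
  refine Finset.sum_congr rfl fun c _ => ?_
  simp [reprTmul, spread_cocyc_tmul, ← mul_assoc]

/-- The representation `Δ 1 = 1 ⊗ 1`. -/
def reprOfOne : Coalgebra.Repr k (1 : H) Unit where
  index := Finset.univ
  left _ := 1
  right _ := 1
  eq := by simp [Algebra.TensorProduct.one_def]

section Unital

lemma one_tmul_mul (hwa : IsWeakAction k H A rho) (hmul : IsCrossedMulA k H A rho sgA mul)
    (b : A) (l : H) :
    mul (1 ⊗ₜ 1) (b ⊗ₜ l) = (b ⊗ₜ[k] (1 : H)) *
      spread (cocyc sgA (CoalgHom.id k H) (CoalgHom.id k H))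
        (mulHom (CoalgHom.id k H) (CoalgHom.id k H)) (1 ⊗ₜ l) := by
  rw [mul_tmul_tmul hmul _ _ _ reprOfOne]
  simp [reprOfOne, hwa.2.2]

lemma mul_one_tmul (hwa : IsWeakAction k H A rho) (hmul : IsCrossedMulA k H A rho sgA mul)
    (a : A) (h : H) :
    mul (a ⊗ₜ h) (1 ⊗ₜ 1) = (a ⊗ₜ[k] (1 : H)) *
      spread (cocyc sgA (CoalgHom.id k H) (CoalgHom.id k H))
        (mulHom (CoalgHom.id k H) (CoalgHom.id k H)) (h ⊗ₜ 1) := by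
  rw [mul_tmul_tmul hmul _ _ _ (ℛ k h)]
  conv_rhs => rw [← sum_counit_smul (ℛ k h)]
  simp [hwa.2.1, TensorProduct.sum_tmul, Finset.mul_sum, ← TensorProduct.smul_tmul']

lemma spread_cocyc_one_tmul (hn : NormalA k H A sgA) (l : H) :
    spread (cocyc sgA (CoalgHom.id k H) (CoalgHom.id k H))
      (mulHom (CoalgHom.id k H) (CoalgHom.id k H)) (1 ⊗ₜ l) = 1 ⊗ₜ l := by
  rw [spread_apply _ _ (reprTmul reprOfOne (ℛ k l))]
  refine (Finset.sum_product _ _ _).trans ?_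
  conv_rhs => rw [← sum_counit_smul (ℛ k l)]
  simp [reprTmul, reprOfOne, (hn _).2, TensorProduct.tmul_sum, TensorProduct.smul_tmul]

lemma spread_cocyc_tmul_one (hn : NormalA k H A sgA) (h : H) :
    spread (cocyc sgA (CoalgHom.id k H) (CoalgHom.id k H))
      (mulHom (CoalgHom.id k H) (CoalgHom.id k H)) (h ⊗ₜ 1) = 1 ⊗ₜ h := by
  rw [spread_apply _ _ (reprTmul (ℛ k h) reprOfOne)]
  refine (Finset.sum_product _ _ _).trans ?_
  conv_rhs => rw [← sum_counit_smul (ℛ k h)]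
  simp [reprTmul, reprOfOne, (hn _).1, TensorProduct.tmul_sum, TensorProduct.smul_tmul]

lemma unital_iff_normal (hwa : IsWeakAction k H A rho) (hmul : IsCrossedMulA k H A rho sgA mul) :
    (∀ x : A ⊗[k] H, mul ((1 : A) ⊗ₜ[k] (1 : H)) x = x ∧
        mul x ((1 : A) ⊗ₜ[k] (1 : H)) = x) ↔ NormalA k H A sgA := by
  refine ⟨fun hu h => ⟨?_, ?_⟩, fun hn x => ?_⟩
  · have h₁ := (hu (1 ⊗ₜ h)).2
    rw [mul_one_tmul hwa hmul, ← Algebra.TensorProduct.one_def, one_mul] at h₁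
    have h₂ := rid_counit_spread (cocyc sgA (CoalgHom.id k H) (CoalgHom.id k H))
      (mulHom (CoalgHom.id k H) (CoalgHom.id k H)) (h ⊗ₜ 1)
    rw [h₁] at h₂
    simpa using h₂.symm
  · have h₁ := (hu (1 ⊗ₜ h)).1
    rw [one_tmul_mul hwa hmul, ← Algebra.TensorProduct.one_def, one_mul] at h₁
    have h₂ := rid_counit_spread (cocyc sgA (CoalgHom.id k H) (CoalgHom.id k H))
      (mulHom (CoalgHom.id k H) (CoalgHom.id k H)) (1 ⊗ₜ h)
    rw [h₁] at h₂
    simpa using h₂.symm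
  · induction x using TensorProduct.induction_on with
    | zero => simp
    | tmul a h =>
      simp [one_tmul_mul hwa hmul, mul_one_tmul hwa hmul, spread_cocyc_one_tmul hn,
        spread_cocyc_tmul_one hn]
    | add x y hx hy => simp [hx, hy]

end Unital

section Assoc

variable (k H) in
/-- The coalgebra isomorphism `(h ⊗ l) ⊗ m ↦ h ⊗ (l ⊗ m)`. -/
def assocHom : (H ⊗[k] H) ⊗[k] H →ₗc[k] H ⊗[k] (H ⊗[k] H) :=
  (Coalgebra.TensorProduct.assoc k k H H H : (H ⊗[k] H) ⊗[k] H →ₗc[k] H ⊗[k] (H ⊗[k] H))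

@[simp] lemma assocHom_tmul (h l m : H) : assocHom k H ((h ⊗ₜ l) ⊗ₜ m) = h ⊗ₜ (l ⊗ₜ m) := rfl

lemma mulHom_comp_assocHom :
    (mulHom (CoalgHom.id k H) (mulHom (CoalgHom.id k H) (CoalgHom.id k H))).comp
      (assocHom k H) =
    mulHom (mulHom (CoalgHom.id k H) (CoalgHom.id k H)) (CoalgHom.id k H) :=
  CoalgHom.coe_linearMap_injective
    (TensorProduct.ext_threefold fun h l m => (mul_assoc h l m).symm)

lemma assoc_iff_crossed (hmul : IsCrossedMulA k H A rho sgA mul) :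
    (∀ x y z : A ⊗[k] H, mul (mul x y) z = mul x (mul y z)) ↔ ∀ a b c : A,
      crossed rho sgA
          (crossed rho sgA (cst H a) (CoalgHom.id k H) (cst H b) (CoalgHom.id k H))
          (mulHom (CoalgHom.id k H) (CoalgHom.id k H)) (cst H c) (CoalgHom.id k H) =
        pull (assocHom k H) (crossed rho sgA (cst H a) (CoalgHom.id k H)
          (crossed rho sgA (cst H b) (CoalgHom.id k H) (cst H c) (CoalgHom.id k H))
          (mulHom (CoalgHom.id k H) (CoalgHom.id k H))) := by
  have hl : ∀ (a b c : A) (h l m : H), mul (mul (a ⊗ₜ h) (b ⊗ₜ l)) (c ⊗ₜ m) =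
      spread (crossed rho sgA
          (crossed rho sgA (cst H a) (CoalgHom.id k H) (cst H b) (CoalgHom.id k H))
          (mulHom (CoalgHom.id k H) (CoalgHom.id k H)) (cst H c) (CoalgHom.id k H))
        (mulHom (mulHom (CoalgHom.id k H) (CoalgHom.id k H)) (CoalgHom.id k H))
        ((h ⊗ₜ l) ⊗ₜ m) := fun a b c h l m => by
    rw [← spread_cst_id a h, ← spread_cst_id b l, ← spread_cst_id c m, mul_spread_spread hmul,
      mul_spread_spread hmul]
  have hr : ∀ (a b c : A) (h l m : H), mul (a ⊗ₜ h) (mul (b ⊗ₜ l) (c ⊗ₜ m)) =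
      spread (pull (assocHom k H) (crossed rho sgA (cst H a) (CoalgHom.id k H)
          (crossed rho sgA (cst H b) (CoalgHom.id k H) (cst H c) (CoalgHom.id k H))
          (mulHom (CoalgHom.id k H) (CoalgHom.id k H))))
        (mulHom (mulHom (CoalgHom.id k H) (CoalgHom.id k H)) (CoalgHom.id k H))
        ((h ⊗ₜ l) ⊗ₜ m) := fun a b c h l m => by
    rw [← spread_cst_id a h, ← spread_cst_id b l, ← spread_cst_id c m, mul_spread_spread hmul,
      mul_spread_spread hmul, ← mulHom_comp_assocHom, ← spread_coalgHom_apply, assocHom_tmul]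
  refine ⟨fun ha a b c => spread_injective
    (mulHom (mulHom (CoalgHom.id k H) (CoalgHom.id k H)) (CoalgHom.id k H))
    (TensorProduct.ext_threefold fun h l m => ?_), fun hc x y z => ?_⟩
  · rw [← hl, ← hr, ha]
  · induction x using TensorProduct.induction_on with
    | zero => simp
    | add x x' hx hx' => simp [hx, hx']
    | tmul a h =>
      induction y using TensorProduct.induction_on with
      | zero => simp
      | add y y' hy hy' => simp [hy, hy']
      | tmul b l =>
        induction z using TensorProduct.induction_on with
        | zero => simp
        | add z z' hz hz' => simp [hz, hz']
        | tmul c m => rw [hl, hr, hc]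

/-- The map `x ⊗ y ↦ x(y(c))`. -/
def actAct (rho : H →ₗ[k] A →ₗ[k] A) (c : A) : WithConv (H ⊗[k] H →ₗ[k] A) :=
  act rho (CoalgHom.id k H) (toConv (rho.flip c))

/-- The map `x ⊗ y ↦ (xy)(c)`. -/
def actMul (rho : H →ₗ[k] A →ₗ[k] A) (c : A) : WithConv (H ⊗[k] H →ₗ[k] A) :=
  pull (mulHom (CoalgHom.id k H) (CoalgHom.id k H)) (toConv (rho.flip c))

lemma twistedModule_iff : TwistedModuleA k H A rho sgA ↔ ∀ c : A,
    actAct rho c * cocyc sgA (CoalgHom.id k H) (CoalgHom.id k H) =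
      cocyc sgA (CoalgHom.id k H) (CoalgHom.id k H) * actMul rho c := by
  refine ⟨fun ht c => ?_, fun ht h l c Rh Rl => ?_⟩
  · ext h l
    change (actAct rho c * cocyc sgA (CoalgHom.id k H) (CoalgHom.id k H)) (h ⊗ₜ l) =
      (cocyc sgA (CoalgHom.id k H) (CoalgHom.id k H) * actMul rho c) (h ⊗ₜ l)
    rw [convMul_tmul _ _ (ℛ k h) (ℛ k l), convMul_tmul _ _ (ℛ k h) (ℛ k l)]
    exact ht h l c (iterReprOne (ℛ k h)) (iterReprOne (ℛ k l))
  · have h₁ := congrArg (fun f => f (h ⊗ₜ l)) (ht c)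
    simp only [convMul_tmul _ _ (reprOfIterRepr Rh) (reprOfIterRepr Rl)] at h₁
    exact h₁

lemma cocycle_iff : CocycleA k H A rho sgA ↔
    pull (assocHom k H) (act rho (CoalgHom.id k H)
        (cocyc sgA (CoalgHom.id k H) (CoalgHom.id k H))) *
      pull (assocHom k H) (cocyc sgA (CoalgHom.id k H)
        (mulHom (CoalgHom.id k H) (CoalgHom.id k H))) =
    pull (prLeft (H ⊗[k] H) H) (cocyc sgA (CoalgHom.id k H) (CoalgHom.id k H)) *
      cocyc sgA (mulHom (CoalgHom.id k H) (CoalgHom.id k H)) (CoalgHom.id k H) := by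
  have hl : ∀ {ι κ ν : Type} (h l m : H) (Rh : Coalgebra.Repr k h ι) (Rl : Coalgebra.Repr k l κ)
      (Rm : Coalgebra.Repr k m ν),
      (pull (assocHom k H) (act rho (CoalgHom.id k H)
        (cocyc sgA (CoalgHom.id k H) (CoalgHom.id k H))) *
      pull (assocHom k H) (cocyc sgA (CoalgHom.id k H)
        (mulHom (CoalgHom.id k H) (CoalgHom.id k H)))) ((h ⊗ₜ l) ⊗ₜ m) =
      ∑ i ∈ Rh.index, ∑ j ∈ Rl.index, ∑ c ∈ Rm.index,
        rho (Rh.left i) (sgA (Rl.left j) (Rm.left c)) *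
          sgA (Rh.right i) (Rl.right j * Rm.right c) := fun h l m Rh Rl Rm => by
    rw [convMul_tmul _ _ (reprTmul Rh Rl) Rm]
    exact Finset.sum_product _ _ _
  have hr : ∀ {ι κ : Type} (h l m : H) (Rh : Coalgebra.Repr k h ι) (Rl : Coalgebra.Repr k l κ),
      (pull (prLeft (H ⊗[k] H) H) (cocyc sgA (CoalgHom.id k H) (CoalgHom.id k H)) *
        cocyc sgA (mulHom (CoalgHom.id k H) (CoalgHom.id k H)) (CoalgHom.id k H))
          ((h ⊗ₜ l) ⊗ₜ m) =
      ∑ i ∈ Rh.index, ∑ j ∈ Rl.index,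
        sgA (Rh.left i) (Rl.left j) * sgA (Rh.right i * Rl.right j) m := fun h l m Rh Rl => by
    rw [pull_prLeft_mul_tmul _ _ (reprTmul Rh Rl)]
    exact Finset.sum_product _ _ _
  refine ⟨fun hc => ?_, fun hc h l m Rh Rl Rm => ?_⟩
  · refine congrArg toConv (TensorProduct.ext_threefold fun h l m =>
      (hl h l m (ℛ k h) (ℛ k l) (ℛ k m)).trans (Eq.trans ?_ (hr h l m (ℛ k h) (ℛ k l)).symm))
    exact hc h l m (iterReprOne (ℛ k h)) (iterReprOne (ℛ k l)) (iterReprOne (ℛ k m))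
  · exact (hl h l m (reprOfIterRepr Rh) (reprOfIterRepr Rl) (reprOfIterRepr Rm)).symm.trans
      ((congrArg (fun f => f ((h ⊗ₜ l) ⊗ₜ m)) hc).trans
        (hr h l m (reprOfIterRepr Rh) (reprOfIterRepr Rl)))

lemma pull_prLeft_mul_cancel (hn : NormalA k H A sgA) (p : C →ₗc[k] H)
    {f g : WithConv (C →ₗ[k] A)}
    (h : pull (prLeft C H) f * cocyc sgA p (CoalgHom.id k H) =
      pull (prLeft C H) g * cocyc sgA p (CoalgHom.id k H)) : f = g := by
  have hf : ∀ (f : WithConv (C →ₗ[k] A)) (x : C),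
      (pull (prLeft C H) f * cocyc sgA p (CoalgHom.id k H)) (x ⊗ₜ 1) = f x := fun f x => by
    rw [pull_prLeft_mul_tmul _ _ (ℛ k x)]
    conv_rhs => rw [← mul_one f, (ℛ k x).convMul_apply]
    simp [(hn _).1, Algebra.algebraMap_eq_smul_one]
  ext x
  exact (hf f x).symm.trans ((congrArg (fun f => f (x ⊗ₜ 1)) h).trans (hf g x))

lemma crossed_crossed_left (a b c : A) :
    crossed rho sgA
        (crossed rho sgA (cst H a) (CoalgHom.id k H) (cst H b) (CoalgHom.id k H))
        (mulHom (CoalgHom.id k H) (CoalgHom.id k H)) (cst H c) (CoalgHom.id k H) =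
      cst ((H ⊗[k] H) ⊗[k] H) a *
        (pull (prLeft (H ⊗[k] H) H) (act rho (CoalgHom.id k H) (cst H b)) *
        (pull (prLeft (H ⊗[k] H) H) (cocyc sgA (CoalgHom.id k H) (CoalgHom.id k H) *
          actMul rho c) *
        cocyc sgA (mulHom (CoalgHom.id k H) (CoalgHom.id k H)) (CoalgHom.id k H))) := by
  have h₁ : act rho (mulHom (CoalgHom.id k H) (CoalgHom.id k H)) (cst H c) =
      pull (prLeft (H ⊗[k] H) H) (actMul rho c) := by
    refine congrArg toConv (TensorProduct.ext_threefold fun h l m => ?_)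
    change rho (h * l) (counit (R := k) m • c) =
      rho (mulHom (CoalgHom.id k H) (CoalgHom.id k H) (counit (R := k) m • (h ⊗ₜ l))) c
    simp
  simp [crossed, h₁, pull_mul, mul_assoc]

lemma crossed_crossed_right (hwa : IsWeakAction k H A rho) (a b c : A) :
    pull (assocHom k H) (crossed rho sgA (cst H a) (CoalgHom.id k H)
        (crossed rho sgA (cst H b) (CoalgHom.id k H) (cst H c) (CoalgHom.id k H))
        (mulHom (CoalgHom.id k H) (CoalgHom.id k H))) =
      cst ((H ⊗[k] H) ⊗[k] H) a *
        (pull (prLeft (H ⊗[k] H) H) (act rho (CoalgHom.id k H) (cst H b)) *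
        (pull (prLeft (H ⊗[k] H) H) (actAct rho c) *
        (pull (assocHom k H) (act rho (CoalgHom.id k H)
          (cocyc sgA (CoalgHom.id k H) (CoalgHom.id k H))) *
        pull (assocHom k H) (cocyc sgA (CoalgHom.id k H)
          (mulHom (CoalgHom.id k H) (CoalgHom.id k H)))))) := by
  have h₁ : pull (assocHom k H) (act rho (CoalgHom.id k H) (cst (H ⊗[k] H) b)) =
      pull (prLeft (H ⊗[k] H) H) (act rho (CoalgHom.id k H) (cst H b)) := by
    refine congrArg toConv (TensorProduct.ext_threefold fun h l m => ?_)
    change rho h (counit (R := k) (l ⊗ₜ[k] m) • b) =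
      act rho (CoalgHom.id k H) (cst H b) (counit (R := k) m • (h ⊗ₜ l))
    simp [smul_smul, mul_comm]
  have h₂ : pull (assocHom k H) (act rho (CoalgHom.id k H)
        (act rho (CoalgHom.id k H) (cst H c))) =
      pull (prLeft (H ⊗[k] H) H) (actAct rho c) := by
    refine congrArg toConv (TensorProduct.ext_threefold fun h l m => ?_)
    change rho h (rho l (counit (R := k) m • c)) =
      actAct rho c (counit (R := k) m • (h ⊗ₜ l))
    simp [actAct]
  simp [crossed, h₁, h₂, pull_mul, act_mul hwa, mul_assoc]

lemma actMul_one (hwa : IsWeakAction k H A rho) : actMul rho 1 = 1 := by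
  ext h l
  change rho (h * l) 1 = algebraMap k A (counit (R := k) (h ⊗ₜ[k] l))
  simp [hwa.2.1, Algebra.algebraMap_eq_smul_one, mul_comm]

lemma actAct_one (hwa : IsWeakAction k H A rho) : actAct rho 1 = 1 := by
  ext h l
  change rho h (rho l 1) = algebraMap k A (counit (R := k) (h ⊗ₜ[k] l))
  simp [hwa.2.1, Algebra.algebraMap_eq_smul_one, smul_smul]

lemma pull_one (p : C →ₗc[k] D) : pull p (1 : WithConv (D →ₗ[k] A)) = 1 := by
  rw [← cst_one, pull_cst, cst_one]

lemma assoc_iff_cocycle_twisted (hwa : IsWeakAction k H A rho)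
    (hmul : IsCrossedMulA k H A rho sgA mul) (hn : NormalA k H A sgA) :
    (∀ x y z : A ⊗[k] H, mul (mul x y) z = mul x (mul y z)) ↔
      CocycleA k H A rho sgA ∧ TwistedModuleA k H A rho sgA := by
  simp only [assoc_iff_crossed hmul, cocycle_iff, twistedModule_iff, crossed_crossed_left,
    crossed_crossed_right hwa]
  refine ⟨fun h => ?_, fun h a b c => by rw [← h.2, h.1, pull_mul, mul_assoc]⟩
  have h₁ := fun c => h 1 1 c
  simp only [cst_one, act_one hwa, pull_one, one_mul] at h₁
  have hc := h₁ 1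
  rw [actMul_one hwa, actAct_one hwa, pull_one, mul_one, one_mul] at hc
  refine ⟨hc.symm, fun c => (pull_prLeft_mul_cancel hn _ ((h₁ c).trans ?_)).symm⟩
  rw [← hc, pull_mul, mul_assoc]

end Assoc

end Crossed

end CrossedProduct

/-- The multiplication `(a ⊗ h)(b ⊗ l) = a h⁽¹⁾(b) σ(h⁽²⁾,l⁽¹⁾) ⊗ h⁽³⁾l⁽²⁾`
on `A ⊗ H` is associative with unit `1 ⊗ 1` if and only if `σ` and the weak action satisfy
the normality, cocycle and twisted module properties. -/
theorem crossedProduct_assoc_unital_iff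
    (k : Type) [Field k] (H : Type) [Ring H] [HopfAlgebra k H]
    (A : Type) [Ring A] [Algebra k A]
    (rho : H →ₗ[k] A →ₗ[k] A) (sgA : H →ₗ[k] H →ₗ[k] A)
    (hwa : IsWeakAction k H A rho)
    (mul : (A ⊗[k] H) →ₗ[k] (A ⊗[k] H) →ₗ[k] (A ⊗[k] H))
    (hmul : IsCrossedMulA k H A rho sgA mul) :
    ((∀ x y z : A ⊗[k] H, mul (mul x y) z = mul x (mul y z)) ∧
      (∀ x : A ⊗[k] H, mul ((1 : A) ⊗ₜ[k] (1 : H)) x = x ∧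
        mul x ((1 : A) ⊗ₜ[k] (1 : H)) = x)) ↔
    (NormalA k H A sgA ∧ CocycleA k H A rho sgA ∧ TwistedModuleA k H A rho sgA) := by
  rw [CrossedProduct.unital_iff_normal hwa hmul]
  exact ⟨fun h => ⟨h.2, (CrossedProduct.assoc_iff_cocycle_twisted hwa hmul h.2).1 h.1⟩,
    fun h => ⟨(CrossedProduct.assoc_iff_cocycle_twisted hwa hmul h.1).2 h.2, h.1⟩⟩
end
end

section
/- Under the standing assumptions, for all p,q ≥ 0 the operators t and τ on H^{⊗(p+1)}⊗A^{⊗(q+1)} satisfy the cylindrical module condition t^{p+1} ∘ τ^{q+1} = id, where τ(g_0,…,g_p | a_0,…,a_q) = (g_0⁽²⁾,…,g_p⁽²⁾ | S(g_0⁽¹⁾⋯g_p⁽¹⁾)(a_q), a_0,…,a_{q−1}) and t(g_0,…,g_p | a_0,…,a_q) = (g_p^{(q+2)}, g_0,…,g_{p−1} | g_p⁽¹⁾(a_0),…,g_p^{(q+1)}(a_q)). -/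
open TensorProduct

noncomputable section

variable (k : Type) [Field k] (H : Type) [Ring H] [HopfAlgebra k H]

variable (A : Type) [Ring A] [Algebra k A]
variable (rho : H →ₗ[k] A →ₗ[k] A)

variable (sg : H →ₗ[k] H →ₗ[k] k)

/-! ## The operators of the cylindrical module `A ♮_σ H` -/

/-- Spec of the horizontal face `dᵢ` (`0 ≤ i < P`) on `H^{⊗(P+1)} ⊗ A^{⊗(q+1)}`
(here `P = p+1`):
`dᵢ(g₀,…,g_P | a₀,…,a_q) = (g₀,…,gᵢ⁽¹⁾g_{i+1}⁽¹⁾,…,g_P | σ(gᵢ⁽²⁾,g_{i+1}⁽²⁾)a₀, a₁,…,a_q)`. -/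
def IsHorFace (p q : ℕ) (i : Fin (p + 1))
    (D : ((Tpow k H (p + 1) : Type) ⊗[k] (Tpow k A q : Type)) →ₗ[k]
      ((Tpow k H p : Type) ⊗[k] (Tpow k A q : Type))) : Prop :=
  ∀ (g : Fin (p + 2) → H) (a : Fin (q + 1) → A)
    (R : IterRepr k H 1 (g i.castSucc)) (S : IterRepr k H 1 (g i.succ)),
    D (tpow k H (p + 1) g ⊗ₜ[k] tpow k A q a) =
      ∑ r ∈ R.s, ∑ s ∈ S.s,
        tpow k H p (mergeAt i g (R.leg r 0 * S.leg s 0)) ⊗ₜ[k]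
          tpow k A q (Function.update a 0 (sg (R.leg r 1) (S.leg s 1) • a 0))

/-- Spec of the last horizontal face `d_P` on `H^{⊗(P+1)} ⊗ A^{⊗(q+1)}` (here `P = p+1`):
`d_P(g₀,…,g_P | a₀,…,a_q) = (g_P^{(q+2)}g₀⁽¹⁾, g₁,…,g_{P−1} |
σ(g_P^{(q+3)},g₀⁽²⁾)g_P⁽¹⁾(a₀), g_P⁽²⁾(a₁),…,g_P^{(q+1)}(a_q))`. -/
def IsLastHorFace (p q : ℕ)
    (D : ((Tpow k H (p + 1) : Type) ⊗[k] (Tpow k A q : Type)) →ₗ[k]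
      ((Tpow k H p : Type) ⊗[k] (Tpow k A q : Type))) : Prop :=
  ∀ (g : Fin (p + 2) → H) (a : Fin (q + 1) → A)
    (R : IterRepr k H (q + 2) (g (Fin.last (p + 1)))) (S : IterRepr k H 1 (g 0)),
    D (tpow k H (p + 1) g ⊗ₜ[k] tpow k A q a) =
      ∑ r ∈ R.s, ∑ s ∈ S.s,
        tpow k H p
          (Fin.cases (R.leg r ⟨q + 1, by omega⟩ * S.leg s 0)
            (fun j : Fin p => g j.succ.castSucc)) ⊗ₜ[k]
        tpow k A q (fun c : Fin (q + 1) =>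
          if c = 0 then
            sg (R.leg r ⟨q + 2, by omega⟩) (S.leg s 1) • rho (R.leg r 0) (a 0)
          else rho (R.leg r (Fin.castLE (by omega) c)) (a c))

/-- Spec of the horizontal cyclic operator `t` on `H^{⊗(p+1)} ⊗ A^{⊗(q+1)}`:
`t(g₀,…,g_p | a₀,…,a_q) = (g_p^{(q+2)}, g₀,…,g_{p−1} | g_p⁽¹⁾(a₀),…,g_p^{(q+1)}(a_q))`. -/
def IsCycT (p q : ℕ)
    (T : ((Tpow k H p : Type) ⊗[k] (Tpow k A q : Type)) →ₗ[k]
      ((Tpow k H p : Type) ⊗[k] (Tpow k A q : Type))) : Prop :=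
  ∀ (g : Fin (p + 1) → H) (a : Fin (q + 1) → A)
    (R : IterRepr k H (q + 1) (g (Fin.last p))),
    T (tpow k H p g ⊗ₜ[k] tpow k A q a) =
      ∑ r ∈ R.s,
        tpow k H p (Fin.cases (R.leg r (Fin.last (q + 1))) (fun j : Fin p => g j.castSucc))
          ⊗ₜ[k]
        tpow k A q (fun c : Fin (q + 1) => rho (R.leg r c.castSucc) (a c))

/-- Spec of the vertical cyclic operator `τ` on `H^{⊗(p+1)} ⊗ A^{⊗(q+1)}`:
`τ(g₀,…,g_p | a₀,…,a_q) = (g₀⁽²⁾,…,g_p⁽²⁾ | S(g₀⁽¹⁾⋯g_p⁽¹⁾)(a_q), a₀,…,a_{q−1})`. -/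
def IsCycTau (p q : ℕ)
    (T : ((Tpow k H p : Type) ⊗[k] (Tpow k A q : Type)) →ₗ[k]
      ((Tpow k H p : Type) ⊗[k] (Tpow k A q : Type))) : Prop :=
  ∀ (g : Fin (p + 1) → H) (a : Fin (q + 1) → A)
    (R : ∀ i : Fin (p + 1), IterRepr k H 1 (g i)),
    T (tpow k H p g ⊗ₜ[k] tpow k A q a) =
      ∑ e ∈ Fintype.piFinset (fun i => (R i).s),
        tpow k H p (fun i => (R i).leg (e i) 1) ⊗ₜ[k]
        tpow k A q
          (Fin.cases
            (rho (HopfAlgebra.antipode (R := k)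
                ((List.ofFn (fun i : Fin (p + 1) => (R i).leg (e i) 0)).prod))
              (a (Fin.last q)))
            (fun c : Fin q => a c.castSucc))

/-- Spec of the vertical face `δᵢ` (`0 ≤ i < Q`) on `H^{⊗(p+1)} ⊗ A^{⊗(Q+1)}`
(here `Q = q+1`): `δᵢ(g | a₀,…,a_Q) = (g | a₀,…,aᵢa_{i+1},…,a_Q)`. -/
def IsVerFace (p q : ℕ) (i : Fin (q + 1))
    (D : ((Tpow k H p : Type) ⊗[k] (Tpow k A (q + 1) : Type)) →ₗ[k]
      ((Tpow k H p : Type) ⊗[k] (Tpow k A q : Type))) : Prop :=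
  ∀ (g : Fin (p + 1) → H) (a : Fin (q + 2) → A),
    D (tpow k H p g ⊗ₜ[k] tpow k A (q + 1) a) =
      tpow k H p g ⊗ₜ[k] tpow k A q (mergeAt i a (a i.castSucc * a i.succ))

/-- Spec of the last vertical face `δ_Q` on `H^{⊗(p+1)} ⊗ A^{⊗(Q+1)}` (here `Q = q+1`):
`δ_Q(g₀,…,g_p | a₀,…,a_Q) = (g₀⁽²⁾,…,g_p⁽²⁾ | S(g₀⁽¹⁾⋯g_p⁽¹⁾)(a_Q)a₀, a₁,…,a_{Q−1})`. -/
def IsLastVerFace (p q : ℕ)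
    (D : ((Tpow k H p : Type) ⊗[k] (Tpow k A (q + 1) : Type)) →ₗ[k]
      ((Tpow k H p : Type) ⊗[k] (Tpow k A q : Type))) : Prop :=
  ∀ (g : Fin (p + 1) → H) (a : Fin (q + 2) → A)
    (R : ∀ i : Fin (p + 1), IterRepr k H 1 (g i)),
    D (tpow k H p g ⊗ₜ[k] tpow k A (q + 1) a) =
      ∑ e ∈ Fintype.piFinset (fun i => (R i).s),
        tpow k H p (fun i => (R i).leg (e i) 1) ⊗ₜ[k]
        tpow k A q
          (Fin.cases
            (rho (HopfAlgebra.antipode (R := k)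
                ((List.ofFn (fun i : Fin (p + 1) => (R i).leg (e i) 0)).prod))
              (a (Fin.last (q + 1))) * a 0)
            (fun c : Fin q => a c.succ.castSucc))

/-! ## Operators attached to linear maps out of a coalgebra -/

section Coact

variable {k C M : Type} [Field k] [AddCommGroup C] [Module k C]
  [AddCommGroup M] [Module k M]

theorem lTensor_lift_assoc_tmul {D : Type} [AddCommGroup D] [Module k D]
    (f : C →ₗ[k] Module.End k M) (z : D ⊗[k] C) (m : M) :
    LinearMap.lTensor D (TensorProduct.lift f) (TensorProduct.assoc k D C M (z ⊗ₜ m)) =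
      LinearMap.lTensor D (f.flip m) z := by
  induction z with
  | zero => simp
  | tmul x y => simp
  | add x y hx hy => simp only [add_tmul, map_add, hx, hy]

variable [Coalgebra k C]

/-- The operator `c ⊗ m ↦ c⁽¹⁾ ⊗ f(c⁽²⁾)(m)` on `C ⊗ M` attached to `f : C → End M`. -/
def coact (f : C →ₗ[k] Module.End k M) : Module.End k (C ⊗[k] M) :=
  LinearMap.lTensor C (TensorProduct.lift f) ∘ₗ (TensorProduct.assoc k C C M).toLinearMap ∘ₗ
    LinearMap.rTensor M Coalgebra.comul

theorem coact_tmul (f : C →ₗ[k] Module.End k M) (c : C) (m : M) :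
    coact f (c ⊗ₜ m) = LinearMap.lTensor C (f.flip m) (Coalgebra.comul c) := by
  simp only [coact, LinearMap.comp_apply, LinearMap.rTensor_tmul, LinearEquiv.coe_coe]
  exact lTensor_lift_assoc_tmul f _ m

theorem coact_mul (f g h : C →ₗ[k] Module.End k M)
    (H : ∀ c, h c = LinearMap.mul' k _ (TensorProduct.map f g (Coalgebra.comul c))) :
    coact f * coact g = coact h := by
  ext c m
  simp only [AlgebraTensorModule.curry_apply, LinearMap.restrictScalars_self, curry_apply,
    Module.End.mul_apply, coact_tmul]
  have key : ∀ z : C ⊗[k] C, coact f (LinearMap.lTensor C (g.flip m) z) =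
      LinearMap.lTensor C ((LinearMap.mul' k (Module.End k M) ∘ₗ TensorProduct.map f g).flip m)
        (TensorProduct.assoc k C C C (LinearMap.rTensor C Coalgebra.comul z)) := by
    intro z
    induction z with
    | zero => simp
    | add x y hx hy => simp only [map_add, hx, hy]
    | tmul x y =>
      simp only [LinearMap.lTensor_tmul, coact_tmul, LinearMap.rTensor_tmul]
      induction (Coalgebra.comul (R := k) x) with
      | zero => simp
      | add x y hx hy => simp only [map_add, add_tmul, hx, hy]
      | tmul u v => simp
  rw [key, Coalgebra.coassoc_apply]
  induction (Coalgebra.comul (R := k) c) with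
  | zero => simp
  | add x y hx hy => simp only [map_add, hx, hy]
  | tmul u v => simp [H]

theorem coact_one (f : C →ₗ[k] Module.End k M)
    (H : ∀ c, f c = Coalgebra.counit (R := k) c • (1 : Module.End k M)) : coact f = 1 := by
  ext c m
  simp only [AlgebraTensorModule.curry_apply, LinearMap.restrictScalars_self, curry_apply,
    Module.End.one_apply, coact_tmul]
  have key : f.flip m = (LinearMap.toSpanSingleton k M m) ∘ₗ Coalgebra.counit := by
    ext c
    simp [H]
  rw [key, LinearMap.lTensor_comp, LinearMap.comp_apply, Coalgebra.lTensor_counit_comul]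
  simp

theorem coact_commute [Coalgebra.IsCocomm k C] (f g : C →ₗ[k] Module.End k M)
    (H : ∀ x y, f x * g y = g y * f x) : Commute (coact f) (coact g) := by
  let h := LinearMap.mul' k (Module.End k M) ∘ₗ TensorProduct.map f g ∘ₗ Coalgebra.comul
  have h1 : coact f * coact g = coact h := coact_mul f g h fun _ => rfl
  have h2 : coact g * coact f = coact h := by
    refine coact_mul g f h fun c => ?_
    conv_rhs => rw [← Coalgebra.comm_comul k c]
    simp only [h, LinearMap.comp_apply]
    induction (Coalgebra.comul (R := k) c) with
    | zero => simp
    | add x y hx hy => simp only [map_add, hx, hy]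
    | tmul u v => simp [H]
  exact h1.trans h2.symm

theorem coact_tmul_of_cocomm [Coalgebra.IsCocomm k C] (f : C →ₗ[k] Module.End k M)
    (c : C) (m : M) :
    coact f (c ⊗ₜ m) =
      TensorProduct.comm k M C (LinearMap.rTensor C (f.flip m) (Coalgebra.comul c)) := by
  rw [coact_tmul, ← Coalgebra.comm_comul k c]
  conv_rhs => rw [Coalgebra.comm_comul k c]
  induction (Coalgebra.comul (R := k) c) with
  | zero => simp
  | add x y hx hy => simp only [map_add, hx, hy]
  | tmul u v => simp

theorem coact_rTensor {D : Type} [AddCommGroup D] [Module k D] [Coalgebra k D]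
    (J : D →ₗ[k] C) (f : C →ₗ[k] Module.End k M) (f' : D →ₗ[k] Module.End k M)
    (H : ∀ d, LinearMap.lTensor C f (Coalgebra.comul (J d)) =
      TensorProduct.map J f' (Coalgebra.comul d)) (z : D ⊗[k] M) :
    coact f (LinearMap.rTensor M J z) = LinearMap.rTensor M J (coact f' z) := by
  induction z with
  | zero => simp
  | add x y hx hy => simp only [map_add, hx, hy]
  | tmul d m =>
    simp only [LinearMap.rTensor_tmul, coact_tmul]
    have h1 : f.flip m = LinearMap.applyₗ m ∘ₗ f := by ext; simp
    rw [h1, LinearMap.lTensor_comp, LinearMap.comp_apply, H]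
    induction (Coalgebra.comul (R := k) d) with
    | zero => simp
    | add x y hx hy => simp only [map_add, hx, hy]
    | tmul u v => simp

theorem coact_lTensor {N : Type} [AddCommGroup N] [Module k N] (Q : M →ₗ[k] N)
    (f : C →ₗ[k] Module.End k M) (f' : C →ₗ[k] Module.End k N)
    (H : ∀ c m, Q (f c m) = f' c (Q m)) (z : C ⊗[k] M) :
    LinearMap.lTensor C Q (coact f z) = coact f' (LinearMap.lTensor C Q z) := by
  induction z with
  | zero => simp
  | add x y hx hy => simp only [map_add, hx, hy]
  | tmul c m =>
    simp only [LinearMap.lTensor_tmul, coact_tmul]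
    induction (Coalgebra.comul (R := k) c) with
    | zero => simp
    | add x y hx hy => simp only [map_add, hx, hy]
    | tmul u v => simp [H]

end Coact

/-! ## Tensor powers -/

section TensorPower

variable (k : Type) [Field k] (V : Type) [AddCommGroup V] [Module k V]

/-- The identification of `V ⊗ V^{⊗(n+1)}` with `V^{⊗(n+2)}`. -/
def tpowCons (n : ℕ) : V ⊗[k] Tpow k V n ≃ₗ[k] Tpow k V (n + 1) :=
  LinearEquiv.refl k (V ⊗[k] Tpow k V n)

variable {k V}

theorem tpow_succ (n : ℕ) (f : Fin (n + 2) → V) :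
    tpow k V (n + 1) f = tpowCons k V n (f 0 ⊗ₜ tpow k V n (fun i => f i.succ)) :=
  rfl

theorem tpow_induction {n : ℕ} {P : Tpow k V n → Prop} (x : Tpow k V n) (zero : P 0)
    (tpow : ∀ f, P (tpow k V n f)) (add : ∀ x y, P x → P y → P (x + y)) : P x := by
  induction n with
  | zero => exact tpow (fun _ => x)
  | succ n ih =>
    obtain ⟨z, rfl⟩ := (tpowCons k V n).surjective x
    induction z with
    | zero => rw [map_zero]; exact zero
    | add x y hx hy => rw [map_add]; exact add _ _ hx hy
    | tmul v w =>
      refine ih (P := fun w => P (tpowCons k V n (v ⊗ₜ w))) w ?_ (fun f => ?_) ?_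
      · simpa only [tmul_zero, map_zero] using zero
      · exact tpow (Fin.cons v f)
      · intro x y hx hy
        simpa only [tmul_add, map_add] using add _ _ hx hy

theorem tpow_ext {n : ℕ} {W : Type} [AddCommGroup W] [Module k W]
    {F G : Tpow k V n →ₗ[k] W} (h : ∀ f, F (tpow k V n f) = G (tpow k V n f)) : F = G := by
  ext x
  induction x using tpow_induction with
  | zero => simp only [map_zero]
  | tpow f => exact h f
  | add x y hx hy => simp only [map_add, hx, hy]

theorem exists_sum_tpow {n : ℕ} (x : Tpow k V n) :
    ∃ (m : ℕ) (f : Fin m → Fin (n + 1) → V), ∑ i, tpow k V n (f i) = x := by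
  induction x using tpow_induction with
  | zero => exact ⟨0, Fin.elim0, by simp⟩
  | tpow f => exact ⟨1, fun _ => f, by simp⟩
  | add x y hx hy =>
    obtain ⟨m, f, rfl⟩ := hx
    obtain ⟨l, g, rfl⟩ := hy
    exact ⟨m + l, Fin.append f g, by simp [Fin.sum_univ_add]⟩

/-- Moving the last tensor factor to the front. -/
def tpowRot : (n : ℕ) → Module.End k (Tpow k V n)
  | 0 => LinearMap.id
  | 1 => (TensorProduct.comm k V V).toLinearMap
  | n + 2 =>
    ((TensorProduct.leftComm k V V (Tpow k V n)).toLinearMap ∘ₗ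
      LinearMap.lTensor V (tpowRot (n + 1)) :
        V ⊗[k] (V ⊗[k] Tpow k V n) →ₗ[k] V ⊗[k] (V ⊗[k] Tpow k V n))

theorem tpowRot_tpow (n : ℕ) (f : Fin (n + 1) → V) :
    tpowRot n (tpow k V n f) = tpow k V n (fun i => f (i - 1)) := by
  have key : ∀ m (g : Fin (m + 2) → V), tpowRot (m + 1) (tpow k V (m + 1) g) =
      tpow k V (m + 1) (Fin.cons (g (Fin.last _)) (fun i => g i.castSucc)) := by
    intro m
    induction m with
    | zero => intro g; rfl
    | succ m ih =>
      intro g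
      change TensorProduct.leftComm k V V (Tpow k V m)
        (g 0 ⊗ₜ tpowRot (m + 1) (tpow k V (m + 1) fun i => g i.succ)) = _
      rw [ih]
      rfl
  cases n with
  | zero =>
    change tpow k V 0 f = _
    congr 1
    ext i
    congr 1
    exact Subsingleton.elim (α := Fin 1) _ _
  | succ n =>
    rw [key]
    congr 1
    ext i
    refine Fin.cases ?_ (fun j => ?_) i
    · rw [Fin.cons_zero]
      congr 1
      simp [Fin.ext_iff]
    · rw [Fin.cons_succ]
      congr 1
      rw [eq_sub_iff_add_eq, Fin.coeSucc_eq_succ]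

theorem tpowRot_pow (n : ℕ) : tpowRot (k := k) (V := V) n ^ (n + 1) = 1 := by
  have key : ∀ (m : ℕ) (f : Fin (n + 1) → V),
      (tpowRot n ^ m) (tpow k V n f) =
        tpow k V n (fun i => f (i - m • 1)) := by
    intro m
    induction m with
    | zero => intro f; simp
    | succ m ih =>
      intro f
      rw [pow_succ, Module.End.mul_apply, tpowRot_tpow, ih]
      congr 1
      ext i
      congr 1
      rw [succ_nsmul']
      abel
  refine tpow_ext fun f => ?_
  have h : (n + 1) • (1 : Fin (n + 1)) = 0 := by
    simpa using card_nsmul_eq_zero' (x := (1 : Fin (n + 1)))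
  rw [key, h]
  simp

end TensorPower

/-! ## The coalgebra structure on tensor powers of `H` -/

section TpowCoalgebra

instance tpowCoalgebra : (n : ℕ) → Coalgebra k (Tpow k H n)
  | 0 => inferInstanceAs (Coalgebra k H)
  | n + 1 =>
    letI := tpowCoalgebra n
    inferInstanceAs (Coalgebra k (H ⊗[k] Tpow k H n))

theorem tpow_isCocomm [hH : Coalgebra.IsCocomm k H] (n : ℕ) :
    Coalgebra.IsCocomm k (Tpow k H n) := by
  induction n with
  | zero => exact hH
  | succ n ih => exact inferInstanceAs (Coalgebra.IsCocomm k (H ⊗[k] Tpow k H n))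

theorem comul_tpowCons (n : ℕ) (x : H) (y : Tpow k H n) :
    Coalgebra.comul (R := k) (tpowCons k H n (x ⊗ₜ y)) =
      TensorProduct.map (tpowCons k H n).toLinearMap (tpowCons k H n).toLinearMap
        (TensorProduct.tensorTensorTensorComm k H H (Tpow k H n) (Tpow k H n)
          (Coalgebra.comul (R := k) x ⊗ₜ Coalgebra.comul (R := k) y)) := by
  change _ = TensorProduct.map LinearMap.id LinearMap.id _
  rw [TensorProduct.map_id]
  rfl

theorem counit_tpowCons (n : ℕ) (x : H) (y : Tpow k H n) :
    Coalgebra.counit (R := k) (tpowCons k H n (x ⊗ₜ y)) =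
      Coalgebra.counit (R := k) x * Coalgebra.counit (R := k) y :=
  mul_comm _ _

/-- Swapping the first two tensor factors commutes with the comultiplication. -/
theorem comul_leftComm (n : ℕ) (z : H ⊗[k] (H ⊗[k] Tpow k H n)) :
    Coalgebra.comul (R := k) (TensorProduct.leftComm k H H (Tpow k H n) z) =
      TensorProduct.map (TensorProduct.leftComm k H H (Tpow k H n)).toLinearMap
        (TensorProduct.leftComm k H H (Tpow k H n)).toLinearMap (Coalgebra.comul (R := k) z) := by
  induction z with
  | zero => simp
  | add x y hx hy => simp only [map_add, hx, hy]
  | tmul x w =>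
  induction w with
  | zero => simp
  | add u v hu hv => simp only [tmul_add, map_add, hu, hv]
  | tmul y c =>
  simp only [TensorProduct.leftComm_tmul, TensorProduct.comul_tmul]
  induction (Coalgebra.comul (R := k) x) with
  | zero => simp
  | add x y hx hy => simp only [map_add, tmul_add, add_tmul, hx, hy]
  | tmul x1 x2 =>
  induction (Coalgebra.comul (R := k) y) with
  | zero => simp
  | add x y hx hy => simp only [map_add, tmul_add, add_tmul, hx, hy]
  | tmul y1 y2 =>
  induction (Coalgebra.comul (R := k) c) with
  | zero => simp
  | add x y hx hy => simp only [map_add, tmul_add, hx, hy]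
  | tmul c1 c2 => simp

theorem comul_comm (z : H ⊗[k] H) :
    Coalgebra.comul (R := k) (TensorProduct.comm k H H z) =
      TensorProduct.map (TensorProduct.comm k H H).toLinearMap
        (TensorProduct.comm k H H).toLinearMap (Coalgebra.comul (R := k) z) := by
  induction z with
  | zero => simp
  | add x y hx hy => simp only [map_add, hx, hy]
  | tmul x y =>
  simp only [TensorProduct.comm_tmul, TensorProduct.comul_tmul]
  induction (Coalgebra.comul (R := k) x) with
  | zero => simp
  | add x y hx hy => simp only [map_add, tmul_add, add_tmul, hx, hy]
  | tmul x1 x2 =>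
  induction (Coalgebra.comul (R := k) y) with
  | zero => simp
  | add x y hx hy => simp only [map_add, tmul_add, add_tmul, hx, hy]
  | tmul y1 y2 => simp

theorem comul_lTensor {D E : Type} [AddCommGroup D] [Module k D] [Coalgebra k D]
    [AddCommGroup E] [Module k E] [Coalgebra k E] (F : D →ₗ[k] E)
    (hF : ∀ d, Coalgebra.comul (R := k) (F d) = TensorProduct.map F F (Coalgebra.comul d))
    (z : H ⊗[k] D) :
    Coalgebra.comul (R := k) (LinearMap.lTensor H F z) =
      TensorProduct.map (LinearMap.lTensor H F) (LinearMap.lTensor H F)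
        (Coalgebra.comul (R := k) z) := by
  induction z with
  | zero => simp
  | add x y hx hy => simp only [map_add, hx, hy]
  | tmul x y =>
  simp only [LinearMap.lTensor_tmul, TensorProduct.comul_tmul, hF]
  induction (Coalgebra.comul (R := k) x) with
  | zero => simp
  | add x y hx hy => simp only [map_add, add_tmul, hx, hy]
  | tmul x1 x2 =>
  induction (Coalgebra.comul (R := k) y) with
  | zero => simp
  | add x y hx hy => simp only [map_add, tmul_add, hx, hy]
  | tmul y1 y2 => simp

theorem comul_comp {D E F : Type} [AddCommGroup D] [Module k D] [Coalgebra k D]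
    [AddCommGroup E] [Module k E] [Coalgebra k E] [AddCommGroup F] [Module k F] [Coalgebra k F]
    (f : D →ₗ[k] E) (g : E →ₗ[k] F)
    (hf : ∀ d, Coalgebra.comul (R := k) (f d) = TensorProduct.map f f (Coalgebra.comul d))
    (hg : ∀ d, Coalgebra.comul (R := k) (g d) = TensorProduct.map g g (Coalgebra.comul d))
    (d : D) : Coalgebra.comul (R := k) ((g ∘ₗ f) d) =
      TensorProduct.map (g ∘ₗ f) (g ∘ₗ f) (Coalgebra.comul d) := by
  rw [TensorProduct.map_comp, LinearMap.comp_apply, LinearMap.comp_apply, hg, hf]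

theorem comul_tpowRot (n : ℕ) (c : Tpow k H n) :
    Coalgebra.comul (R := k) (tpowRot n c) =
      TensorProduct.map (tpowRot n) (tpowRot n) (Coalgebra.comul (R := k) c) := by
  induction n with
  | zero =>
    change _ = TensorProduct.map LinearMap.id LinearMap.id _
    rw [TensorProduct.map_id]
    rfl
  | succ n ih =>
    cases n with
    | zero => exact comul_comm k H c
    | succ n =>
      exact comul_comp k (LinearMap.lTensor H (tpowRot (k := k) (V := H) (n + 1)))
        (TensorProduct.leftComm k H H (Tpow k H n)).toLinearMap
        (comul_lTensor k H (tpowRot (k := k) (V := H) (n + 1)) ih) (comul_leftComm k H n) c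

/-- The comultiplication of an elementary tensor, for given
Sweedler representations of its entries. -/
theorem comul_tpow (n : ℕ) (g : Fin (n + 1) → H) {ι : Fin (n + 1) → Type}
    (s : ∀ i, Finset (ι i)) (x y : ∀ i, ι i → H)
    (h : ∀ i, Coalgebra.comul (R := k) (g i) = ∑ e ∈ s i, x i e ⊗ₜ[k] y i e) :
    Coalgebra.comul (R := k) (tpow k H n g) =
      ∑ e ∈ Fintype.piFinset s,
        tpow k H n (fun i => x i (e i)) ⊗ₜ[k] tpow k H n (fun i => y i (e i)) := by
  induction n with
  | zero =>
    refine (h 0).trans ?_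
    refine Finset.sum_bij' (fun a _ => Fin.cons a (fun i => i.elim0)) (fun e _ => e 0) ?_ ?_ ?_ ?_ ?_
    · intro a ha
      rw [Fintype.mem_piFinset]
      intro i
      obtain rfl : i = 0 := Subsingleton.elim (α := Fin 1) _ _
      exact ha
    · intro e he
      exact Fintype.mem_piFinset.1 he 0
    · intro a ha
      rfl
    · intro e he
      ext i
      obtain rfl : i = 0 := Subsingleton.elim (α := Fin 1) _ _
      rfl
    · intro a ha
      rfl
  | succ n ih =>
    rw [tpow_succ, comul_tpowCons, h 0,
      ih (fun i => g i.succ) (fun i => s i.succ) (fun i => x i.succ) (fun i => y i.succ)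
        (fun i => h i.succ)]
    simp only [sum_tmul, tmul_sum, map_sum, TensorProduct.tensorTensorTensorComm_tmul,
      TensorProduct.map_tmul, LinearEquiv.coe_coe]
    rw [Finset.sum_comm, ← Finset.sum_product']
    refine Finset.sum_bij' (fun a _ => Fin.cons a.1 a.2) (fun e _ => (e 0, fun i => e i.succ))
      ?_ ?_ ?_ ?_ ?_
    · intro a ha
      rw [Finset.mem_product, Fintype.mem_piFinset] at ha
      rw [Fintype.mem_piFinset]
      intro i
      refine Fin.cases ?_ (fun j => ?_) i
      · exact ha.1
      · exact ha.2 j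
    · intro e he
      rw [Fintype.mem_piFinset] at he
      rw [Finset.mem_product, Fintype.mem_piFinset]
      exact ⟨he 0, fun i => he i.succ⟩
    · intro a ha
      rfl
    · intro e he
      ext i
      refine Fin.cases ?_ (fun j => ?_) i <;> rfl
    · intro a ha
      rfl

/-- The product of the first `n` tensor factors, the counit being applied to the other ones:
`g₀ ⊗ ⋯ ⊗ g_p ↦ g₀⋯g_{n-1} ε(g_n)⋯ε(g_p)`. -/
def tpowProd : (p n : ℕ) → Tpow k H p →ₗ[k] H
  | 0, 0 => Algebra.linearMap k H ∘ₗ Coalgebra.counit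
  | 0, _ + 1 => LinearMap.id
  | _ + 1, 0 => Algebra.linearMap k H ∘ₗ Coalgebra.counit
  | p + 1, n + 1 =>
    (LinearMap.mul' k H ∘ₗ LinearMap.lTensor H (tpowProd p n) : H ⊗[k] Tpow k H p →ₗ[k] H)

theorem tpowProd_zero (p : ℕ) (c : Tpow k H p) :
    tpowProd k H p 0 c = algebraMap k H (Coalgebra.counit c) := by
  cases p <;> rfl

theorem tpowProd_tpowCons (p n : ℕ) (x : H) (y : Tpow k H p) :
    tpowProd k H (p + 1) (n + 1) (tpowCons k H p (x ⊗ₜ y)) = x * tpowProd k H p n y :=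
  rfl

theorem tpowProd_one_tpowCons (p : ℕ) (x : H) (y : Tpow k H p) :
    tpowProd k H (p + 1) 1 (tpowCons k H p (x ⊗ₜ y)) =
      Coalgebra.counit (R := k) y • x := by
  rw [tpowProd_tpowCons, tpowProd_zero, Algebra.smul_def]
  exact (Algebra.commutes _ _).symm

theorem tpowProd_tpow (p : ℕ) (g : Fin (p + 1) → H) :
    tpowProd k H p (p + 1) (tpow k H p g) = (List.ofFn g).prod := by
  induction p with
  | zero =>
    rw [List.ofFn_succ, List.ofFn_zero, List.prod_singleton]
    rfl
  | succ p ih =>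
    rw [tpow_succ, tpowProd_tpowCons, ih, List.ofFn_succ (f := g), List.prod_cons]

theorem counit_tpow_succ (p : ℕ) (g : Fin (p + 2) → H) :
    Coalgebra.counit (R := k) (tpow k H (p + 1) g) =
      Coalgebra.counit (R := k) (g (Fin.last _)) *
        Coalgebra.counit (R := k) (tpow k H p fun i => g i.castSucc) := by
  induction p with
  | zero =>
    rw [tpow_succ, counit_tpowCons, mul_comm]
    rfl
  | succ p ih =>
    rw [tpow_succ, counit_tpowCons, ih, tpow_succ p, counit_tpowCons, mul_left_comm]
    rfl

theorem tpowProd_succ_tpow (p n : ℕ) (hn : n ≤ p + 1) (g : Fin (p + 2) → H) :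
    tpowProd k H (p + 1) n (tpow k H (p + 1) g) =
      Coalgebra.counit (R := k) (g (Fin.last _)) •
        tpowProd k H p n (tpow k H p fun i => g i.castSucc) := by
  induction p generalizing n with
  | zero =>
    obtain rfl | rfl : n = 0 ∨ n = 1 := by omega
    · rw [tpowProd_zero, tpowProd_zero, counit_tpow_succ, Algebra.smul_def, map_mul]
    · rw [tpow_succ, tpowProd_one_tpowCons]
      rfl
  | succ p ih =>
    cases n with
    | zero => rw [tpowProd_zero, tpowProd_zero, counit_tpow_succ, Algebra.smul_def, map_mul]
    | succ n =>
      rw [tpow_succ, tpowProd_tpowCons, ih n (by omega), tpow_succ p, tpowProd_tpowCons,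
        mul_smul_comm]
      rfl

/-- The full product map commutes with the comultiplication. -/
theorem comul_tpowProd (p : ℕ) (c : Tpow k H p) :
    Coalgebra.comul (R := k) (tpowProd k H p (p + 1) c) =
      TensorProduct.map (tpowProd k H p (p + 1)) (tpowProd k H p (p + 1))
        (Coalgebra.comul (R := k) c) := by
  induction p with
  | zero =>
    change _ = TensorProduct.map LinearMap.id LinearMap.id _
    rw [TensorProduct.map_id]
    rfl
  | succ p ih =>
    exact comul_comp k (LinearMap.lTensor H (tpowProd k H p (p + 1))) (LinearMap.mul' k H)
      (comul_lTensor k H _ ih)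
      (fun d => (CoalgHomClass.map_comp_comul_apply (Bialgebra.mulCoalgHom k H) d).symm) c

theorem counit_tpowProd (p : ℕ) (c : Tpow k H p) :
    Coalgebra.counit (R := k) (tpowProd k H p (p + 1) c) = Coalgebra.counit (R := k) c := by
  induction p with
  | zero => rfl
  | succ p ih =>
    obtain ⟨z, rfl⟩ := (tpowCons k H p).surjective c
    induction z with
    | zero => simp only [map_zero]
    | add x y hx hy => simp only [map_add, hx, hy]
    | tmul x y => rw [tpowProd_tpowCons, Bialgebra.counit_mul, ih, counit_tpowCons]

theorem tpowProd_mul_antipode (p : ℕ) (c : Tpow k H p) :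
    LinearMap.mul' k H (TensorProduct.map (tpowProd k H p (p + 1))
      (HopfAlgebra.antipode k ∘ₗ tpowProd k H p (p + 1)) (Coalgebra.comul (R := k) c)) =
      algebraMap k H (Coalgebra.counit c) := by
  have h := HopfAlgebra.mul_antipode_lTensor_comul_apply (R := k) (tpowProd k H p (p + 1) c)
  rw [comul_tpowProd, counit_tpowProd] at h
  rw [← h, ← LinearMap.lTensor_comp_map]
  rfl

theorem mul'_map_counit_comul (h : H) :
    LinearMap.mul' k H (TensorProduct.map LinearMap.id
      (Algebra.linearMap k H ∘ₗ Coalgebra.counit) (Coalgebra.comul (R := k) h)) = h := by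
  have h1 := congrArg (TensorProduct.rid k H)
    (Coalgebra.lTensor_counit_comul (R := k) (A := H) h)
  rw [TensorProduct.rid_tmul, one_smul] at h1
  conv_rhs => rw [← h1]
  induction (Coalgebra.comul (R := k) (A := H) h) with
  | zero => simp
  | add x y hx hy => simp only [map_add, hx, hy]
  | tmul x y => simp [Algebra.smul_def, Algebra.commutes]

theorem exists_tpowProd_rot (p n : ℕ) (hn : n ≤ p) :
    ∃ ψ : Tpow k H p →ₗ[k] H, (∀ c, tpowProd k H p n c = ψ (tpowRot p c)) ∧
      ∀ c, tpowProd k H p (n + 1) c = LinearMap.mul' k H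
        (TensorProduct.map (tpowProd k H p 1) ψ (Coalgebra.comul (R := k) c)) := by
  cases p with
  | zero =>
    obtain rfl : n = 0 := by omega
    refine ⟨tpowProd k H 0 0, fun c => rfl, fun c => ?_⟩
    exact (mul'_map_counit_comul k H c).symm
  | succ p =>
    let ψ : Tpow k H (p + 1) →ₗ[k] H :=
      tpowProd k H p n ∘ₗ (TensorProduct.lid k (Tpow k H p)).toLinearMap ∘ₗ
        LinearMap.rTensor (Tpow k H p) Coalgebra.counit ∘ₗ (tpowCons k H p).symm.toLinearMap
    refine ⟨ψ, fun c => ?_, fun c => ?_⟩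
    · have h : tpowProd k H (p + 1) n = ψ ∘ₗ tpowRot (p + 1) := ?_
      · exact LinearMap.congr_fun h c
      refine tpow_ext fun g => ?_
      rw [tpowProd_succ_tpow k H p n hn, LinearMap.comp_apply, tpowRot_tpow, tpow_succ]
      simp only [ψ, LinearMap.comp_apply, LinearEquiv.coe_coe, LinearEquiv.symm_apply_apply,
        LinearMap.rTensor_tmul, TensorProduct.lid_tmul, map_smul]
      congr 3
      · simp [Fin.ext_iff]
      · ext i
        congr 1
        rw [eq_sub_iff_add_eq, Fin.coeSucc_eq_succ]
    · obtain ⟨z, rfl⟩ := (tpowCons k H p).surjective c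
      induction z with
      | zero => simp only [map_zero]
      | add x y hx hy => simp only [map_add, hx, hy]
      | tmul x y =>
      have hx := congrArg (TensorProduct.rid k H)
        (Coalgebra.lTensor_counit_comul (R := k) (A := H) x)
      have hy := congrArg (TensorProduct.lid k (Tpow k H p))
        (Coalgebra.rTensor_counit_comul (R := k) (A := Tpow k H p) y)
      rw [TensorProduct.rid_tmul, one_smul] at hx
      rw [TensorProduct.lid_tmul, one_smul] at hy
      rw [tpowProd_tpowCons, comul_tpowCons]
      conv_lhs => rw [← hx, ← hy]
      induction (Coalgebra.comul (R := k) (A := H) x) with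
      | zero => simp
      | add x y hx hy => simp only [map_add, add_tmul, add_mul, hx, hy]
      | tmul x1 x2 =>
      induction (Coalgebra.comul (R := k) (A := Tpow k H p) y) with
      | zero => simp
      | add x y hx hy => simp only [map_add, tmul_add, mul_add, hx, hy]
      | tmul y1 y2 =>
      simp only [ψ, LinearMap.lTensor_tmul, LinearMap.rTensor_tmul, TensorProduct.rid_tmul,
        TensorProduct.lid_tmul, TensorProduct.tensorTensorTensorComm_tmul,
        TensorProduct.map_tmul, LinearEquiv.coe_coe, LinearMap.mul'_apply, LinearMap.comp_apply,
        LinearEquiv.symm_apply_apply, tpowProd_one_tpowCons, map_smul, smul_mul_assoc,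
        mul_smul_comm]
      rw [smul_comm]

end TpowCoalgebra

/-! ## Ordered products in a monoid -/

section OrderedProducts

variable {M : Type} [Monoid M]

/-- The product `E (n-1) * ⋯ * E 1 * E 0`. -/
def descProd (E : ℕ → M) : ℕ → M
  | 0 => 1
  | n + 1 => E n * descProd E n

/-- The product `E 0 * E 1 * ⋯ * E (n-1)`. -/
def ascProd (E : ℕ → M) : ℕ → M
  | 0 => 1
  | n + 1 => ascProd E n * E n

theorem descProd_mul_descProd {E F G : ℕ → M} (hEF : ∀ i j, i ≠ j → Commute (E i) (F j))
    (hG : ∀ i, E i * F i = G i) (n : ℕ) : descProd E n * descProd F n = descProd G n := by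
  have comm : ∀ m j, m ≤ j → Commute (descProd E m) (F j) := by
    intro m j hm
    induction m with
    | zero => exact Commute.one_left _
    | succ m ih => exact (hEF m j (by omega)).mul_left (ih (by omega))
  induction n with
  | zero => exact mul_one 1
  | succ n ih =>
    simp only [descProd]
    rw [mul_assoc, ← mul_assoc (descProd E n), (comm n n le_rfl).eq, ← hG, ← ih]
    simp only [mul_assoc]

theorem descProd_mul_ascProd {E F : ℕ → M} (h : ∀ i, E i * F i = 1) (n : ℕ) :
    descProd E n * ascProd F n = 1 := by
  induction n with
  | zero => exact mul_one 1
  | succ n ih =>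
    simp only [descProd, ascProd]
    rw [mul_assoc, ← mul_assoc (descProd E n), ih, one_mul, h]

theorem descProd_eq_one {E : ℕ → M} (h : ∀ i, E i = 1) (n : ℕ) : descProd E n = 1 := by
  induction n with
  | zero => rfl
  | succ n ih => rw [descProd, h, ih, mul_one]

theorem descProd_succ_right (E : ℕ → M) (n : ℕ) :
    descProd E (n + 1) = descProd (fun i => E (i + 1)) n * E 0 := by
  induction n with
  | zero => simp [descProd]
  | succ n ih => rw [descProd, ih, descProd, mul_assoc]

theorem mul_pow_eq_ascProd {Q : M} {E : ℕ → M} {q : ℕ}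
    (h : ∀ j < q, SemiconjBy Q (E j) (E (j + 1))) (n : ℕ) (hn : n ≤ q + 1) :
    (E 0 * Q) ^ n = ascProd E n * Q ^ n := by
  have key : ∀ m ≤ q, SemiconjBy (Q ^ m) (E 0) (E m) := by
    intro m hm
    induction m with
    | zero => simp
    | succ m ih =>
      rw [pow_succ']
      exact (h m (by omega)).mul_left (ih (by omega))
  induction n with
  | zero => simp [ascProd]
  | succ n ih =>
    rw [pow_succ, ih (by omega), ascProd, mul_assoc, ← mul_assoc (Q ^ n),
      (key n (by omega)).eq, pow_succ]
    simp only [mul_assoc]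

end OrderedProducts

/-! ## Acting on one tensor factor -/

section SlotAction

variable {k : Type} [Field k] {H : Type} [Ring H] [HopfAlgebra k H]
  {A : Type} [Ring A] [Algebra k A] (rho : H →ₐ[k] Module.End k A)

/-- The action of `H` on the tensor factor of index `j` of `A^{⊗(q+1)}`, for `j ≤ q`. -/
def slotAct : (q j : ℕ) → H →ₐ[k] Module.End k (Tpow k A q)
  | 0, 0 => rho
  | 0, _ + 1 => (Algebra.ofId k (Module.End k A)).comp (Bialgebra.counitAlgHom k H)
  | q + 1, 0 =>
    ((Module.End.rTensorAlgHom k A (Tpow k A q)).comp rho :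
      H →ₐ[k] Module.End k (A ⊗[k] Tpow k A q))
  | q + 1, j + 1 =>
    ((Module.End.lTensorAlgHom k (Tpow k A q) A).comp (slotAct q j) :
      H →ₐ[k] Module.End k (A ⊗[k] Tpow k A q))

theorem slotAct_zero_tpowCons (q : ℕ) (h : H) (a : A) (m : Tpow k A q) :
    slotAct rho (q + 1) 0 h (tpowCons k A q (a ⊗ₜ m)) = tpowCons k A q (rho h a ⊗ₜ m) :=
  rfl

theorem slotAct_succ_tpowCons (q j : ℕ) (h : H) (a : A) (m : Tpow k A q) :
    slotAct rho (q + 1) (j + 1) h (tpowCons k A q (a ⊗ₜ m)) =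
      tpowCons k A q (a ⊗ₜ slotAct rho q j h m) :=
  rfl

theorem slotAct_zero_succ (j : ℕ) (h : H) :
    slotAct rho 0 (j + 1) h =
      algebraMap k (Module.End k (Tpow k A 0)) (Coalgebra.counit (R := k) h) :=
  rfl

theorem slotAct_commute (q i j : ℕ) (hij : i ≠ j) (x y : H) :
    slotAct rho q i x * slotAct rho q j y = slotAct rho q j y * slotAct rho q i x := by
  induction q generalizing i j with
  | zero =>
    cases i with
    | zero =>
      cases j with
      | zero => exact absurd rfl hij
      | succ j =>
        rw [slotAct_zero_succ]
        exact (Algebra.commutes _ _).symm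
    | succ i =>
      rw [slotAct_zero_succ]
      exact Algebra.commutes _ _
  | succ q ih =>
    refine LinearMap.ext fun z => ?_
    obtain ⟨z, rfl⟩ := (tpowCons k A q).surjective z
    induction z with
    | zero => simp only [map_zero]
    | add u v hu hv => simp only [map_add, hu, hv]
    | tmul a m =>
      simp only [Module.End.mul_apply]
      cases i with
      | zero =>
        cases j with
        | zero => exact absurd rfl hij
        | succ j => simp only [slotAct_zero_tpowCons, slotAct_succ_tpowCons]
      | succ i =>
        cases j with
        | zero => simp only [slotAct_zero_tpowCons, slotAct_succ_tpowCons]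
        | succ j =>
          have h := LinearMap.congr_fun (ih i j (by omega)) m
          simp only [Module.End.mul_apply] at h
          simp only [slotAct_succ_tpowCons, h]

theorem slotAct_tpow (q : ℕ) (j : Fin (q + 1)) (h : H) (a : Fin (q + 1) → A) :
    slotAct rho q j h (tpow k A q a) =
      tpow k A q (Function.update a j (rho h (a j))) := by
  induction q with
  | zero =>
    obtain rfl : j = 0 := Fin.fin_one_eq_zero j
    simp only [tpow, Function.update_self]
    rfl
  | succ q ih =>
    rw [tpow_succ, tpow_succ]
    cases j using Fin.cases with
    | zero =>
      rw [Fin.val_zero, slotAct_zero_tpowCons, Function.update_self]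
      rfl
    | succ j =>
      rw [Fin.val_succ, slotAct_succ_tpowCons, ih,
        Function.update_of_ne (Fin.succ_ne_zero j).symm]
      congr 3
      ext i
      by_cases hi : i = j
      · subst hi
        simp
      · rw [Function.update_of_ne hi, Function.update_of_ne (by simpa using hi)]

theorem tpowRot_slotAct (q j : ℕ) (hj : j < q) (h : H) (m : Tpow k A q) :
    tpowRot q (slotAct rho q j h m) = slotAct rho q (j + 1) h (tpowRot q m) := by
  have key : tpowRot q ∘ₗ slotAct rho q j h = slotAct rho q (j + 1) h ∘ₗ tpowRot q := by
    refine tpow_ext fun a => ?_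
    have h1 := slotAct_tpow rho q (⟨j, hj⟩ : Fin q).castSucc h
    have h2 := slotAct_tpow rho q (⟨j, hj⟩ : Fin q).succ h
    simp only [Fin.val_castSucc, Fin.val_succ] at h1 h2
    simp only [LinearMap.comp_apply, tpowRot_tpow, h1, h2]
    congr 1
    have h3 : (⟨j, hj⟩ : Fin q).succ - 1 = (⟨j, hj⟩ : Fin q).castSucc := by
      rw [sub_eq_iff_eq_add, Fin.coeSucc_eq_succ]
    ext i
    by_cases hi : i - 1 = (⟨j, hj⟩ : Fin q).castSucc
    · have hi' : i = (⟨j, hj⟩ : Fin q).succ := by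
        rw [← Fin.coeSucc_eq_succ, ← hi, sub_add_cancel]
      rw [hi', h3, Function.update_self, Function.update_self]
    · have hi' : i ≠ (⟨j, hj⟩ : Fin q).succ := by
        rintro rfl
        exact hi h3
      rw [Function.update_of_ne hi, Function.update_of_ne hi']
  exact LinearMap.congr_fun key m

variable {C : Type} [AddCommGroup C] [Module k C] [Coalgebra k C]

/-- The operator `c ⊗ a₀ ⊗ ⋯ ⊗ a_q ↦ c⁽¹⁾ ⊗ a₀ ⊗ ⋯ ⊗ θ(c⁽²⁾)(a_j) ⊗ ⋯ ⊗ a_q`. -/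
def slotCoact (q : ℕ) (θ : C →ₗ[k] H) (j : ℕ) : Module.End k (C ⊗[k] Tpow k A q) :=
  coact ((slotAct rho q j).toLinearMap ∘ₗ θ)

theorem slotCoact_mul (q : ℕ) {θ θ' θ'' : C →ₗ[k] H}
    (hθ : ∀ c, θ'' c = LinearMap.mul' k H (TensorProduct.map θ θ' (Coalgebra.comul (R := k) c)))
    (j : ℕ) : slotCoact rho q θ j * slotCoact rho q θ' j = slotCoact rho q θ'' j := by
  refine coact_mul _ _ _ fun c => ?_
  rw [LinearMap.comp_apply, hθ]
  induction (Coalgebra.comul (R := k) c) with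
  | zero => simp only [map_zero]
  | add x y hx hy => simp only [map_add, hx, hy]
  | tmul x y => simp

theorem slotCoact_eq_one (q : ℕ) {θ : C →ₗ[k] H}
    (hθ : ∀ c, θ c = algebraMap k H (Coalgebra.counit c)) (j : ℕ) :
    slotCoact rho q θ j = 1 := by
  refine coact_one _ fun c => ?_
  rw [LinearMap.comp_apply, hθ, AlgHom.toLinearMap_apply, AlgHom.commutes,
    Algebra.algebraMap_eq_smul_one]

theorem slotCoact_commute [Coalgebra.IsCocomm k C] (q : ℕ) (θ θ' : C →ₗ[k] H) {i j : ℕ}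
    (hij : i ≠ j) : Commute (slotCoact rho q θ i) (slotCoact rho q θ' j) :=
  coact_commute _ _ fun x y => slotAct_commute rho q i j hij (θ x) (θ' y)

theorem slotCoact_rTensor {D : Type} [AddCommGroup D] [Module k D] [Coalgebra k D] (q : ℕ)
    (J : D →ₗ[k] C) {θ : C →ₗ[k] H} {θ' : D →ₗ[k] H}
    (hJ : ∀ d, LinearMap.lTensor C θ (Coalgebra.comul (J d)) =
      TensorProduct.map J θ' (Coalgebra.comul (R := k) d)) (j : ℕ) (z : D ⊗[k] Tpow k A q) :
    slotCoact rho q θ j (LinearMap.rTensor _ J z) =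
      LinearMap.rTensor _ J (slotCoact rho q θ' j z) := by
  refine coact_rTensor J _ _ (fun d => ?_) z
  rw [LinearMap.lTensor_comp, LinearMap.comp_apply, hJ, ← LinearMap.comp_apply,
    LinearMap.lTensor_comp_map]

theorem descProd_slotCoact_rTensor {D : Type} [AddCommGroup D] [Module k D] [Coalgebra k D]
    (q : ℕ) (J : D →ₗ[k] C) {θ : C →ₗ[k] H} {θ' : D →ₗ[k] H}
    (hJ : ∀ d, LinearMap.lTensor C θ (Coalgebra.comul (J d)) =
      TensorProduct.map J θ' (Coalgebra.comul (R := k) d)) (n : ℕ) (z : D ⊗[k] Tpow k A q) :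
    descProd (slotCoact rho q θ) n (LinearMap.rTensor _ J z) =
      LinearMap.rTensor _ J (descProd (slotCoact rho q θ') n z) := by
  induction n with
  | zero => rfl
  | succ n ih =>
    simp only [descProd, Module.End.mul_apply, ih, slotCoact_rTensor rho q J hJ]

theorem slotCoact_lTensor_tpowRot (q : ℕ) (θ : C →ₗ[k] H) {j : ℕ} (hj : j < q) :
    SemiconjBy (LinearMap.lTensor C (tpowRot q) : Module.End k (C ⊗[k] Tpow k A q))
      (slotCoact rho q θ j) (slotCoact rho q θ (j + 1)) :=
  LinearMap.ext fun z =>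
    coact_lTensor (tpowRot q) _ _ (fun c m => tpowRot_slotAct rho q j hj (θ c) m) z

theorem descProd_slotCoact_lTensor_cons (q : ℕ) (θ : C →ₗ[k] H) (a : A) (n : ℕ)
    (z : C ⊗[k] Tpow k A q) :
    descProd (fun i => slotCoact rho (q + 1) θ (i + 1)) n
        (LinearMap.lTensor C ((tpowCons k A q).toLinearMap ∘ₗ TensorProduct.mk k A _ a) z) =
      LinearMap.lTensor C ((tpowCons k A q).toLinearMap ∘ₗ TensorProduct.mk k A _ a)
        (descProd (slotCoact rho q θ) n z) := by
  induction n with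
  | zero => rfl
  | succ n ih =>
    simp only [descProd, Module.End.mul_apply, ih]
    exact (coact_lTensor _ _ _ (fun c m => rfl) _).symm

end SlotAction

/-! ## The cyclic operators as products of slot operators -/

section CyclicOperators

variable {k : Type} [Field k] {H : Type} [Ring H] [HopfAlgebra k H]
  {A : Type} [Ring A] [Algebra k A]

theorem tpowRot_tpow_eq_cases (n : ℕ) {V : Type} [AddCommGroup V] [Module k V]
    (f : Fin (n + 1) → V) :
    tpowRot n (tpow k V n f) =
      tpow k V n (Fin.cases (f (Fin.last n)) fun i => f i.castSucc) := by
  rw [tpowRot_tpow]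
  congr 1
  ext i
  cases i using Fin.cases with
  | zero =>
    rw [Fin.cases_zero, ← Fin.last_add_one, add_sub_cancel_right]
  | succ i =>
    rw [Fin.cases_succ, ← Fin.coeSucc_eq_succ, add_sub_cancel_right]

variable (k) in
theorem nonempty_iterRepr (n : ℕ) (h : H) : Nonempty (IterRepr k H n h) := by
  obtain ⟨m, f, hf⟩ := exists_sum_tpow (comulIter k H n h)
  exact ⟨⟨Fin m, Finset.univ, f, hf⟩⟩

variable (rho : H →ₐ[k] Module.End k A)

/-- The map `x₀ ⊗ ⋯ ⊗ x_{q+1} ↦ x_{q+1} ⊗ x₀(a₀) ⊗ ⋯ ⊗ x_q(a_q)`. -/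
def actLegs : (q : ℕ) → (Fin (q + 1) → A) → (Tpow k H (q + 1) →ₗ[k] H ⊗[k] Tpow k A q)
  | 0, a =>
    ((TensorProduct.comm k A H).toLinearMap ∘ₗ
      LinearMap.rTensor H (rho.toLinearMap.flip (a 0)) : H ⊗[k] H →ₗ[k] H ⊗[k] A)
  | q + 1, a =>
    (LinearMap.lTensor H (tpowCons k A q).toLinearMap ∘ₗ
      (TensorProduct.leftComm k A H (Tpow k A q)).toLinearMap ∘ₗ
        TensorProduct.map (rho.toLinearMap.flip (a 0)) (actLegs q fun i => a i.succ) :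
      H ⊗[k] Tpow k H (q + 1) →ₗ[k] H ⊗[k] Tpow k A (q + 1))

theorem actLegs_succ_tmul (q : ℕ) (a : Fin (q + 2) → A) (x : H) (y : Tpow k H (q + 1)) :
    actLegs rho (q + 1) a (tpowCons k H (q + 1) (x ⊗ₜ y)) =
      LinearMap.lTensor H ((tpowCons k A q).toLinearMap ∘ₗ TensorProduct.mk k A _ (rho x (a 0)))
        (actLegs rho q (fun i => a i.succ) y) := by
  change LinearMap.lTensor H (tpowCons k A q).toLinearMap
    (TensorProduct.leftComm k A H (Tpow k A q)
      (rho x (a 0) ⊗ₜ actLegs rho q (fun i => a i.succ) y)) = _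
  induction (actLegs rho q (fun i => a i.succ) y) with
  | zero => simp
  | add u v hu hv => simp only [tmul_add, map_add, hu, hv]
  | tmul u v => rfl

theorem actLegs_tpow (q : ℕ) (a : Fin (q + 1) → A) (x : Fin (q + 2) → H) :
    actLegs rho q a (tpow k H (q + 1) x) =
      x (Fin.last _) ⊗ₜ tpow k A q (fun c => rho (x c.castSucc) (a c)) := by
  induction q with
  | zero => rfl
  | succ q ih =>
    rw [tpow_succ, actLegs_succ_tmul, ih]
    rfl

theorem descProd_slotCoact_id [Coalgebra.IsCocomm k H] (q : ℕ) (a : Fin (q + 1) → A) (h : H) :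
    descProd (slotCoact rho q (LinearMap.id : H →ₗ[k] H)) (q + 1) (h ⊗ₜ tpow k A q a) =
      actLegs rho q a (comulIter k H (q + 1) h) := by
  induction q generalizing h with
  | zero =>
    change slotCoact rho 0 LinearMap.id 0 (h ⊗ₜ tpow k A 0 a) =
      TensorProduct.comm k A H (LinearMap.rTensor H (rho.toLinearMap.flip (a 0))
        (LinearMap.lTensor H LinearMap.id (Coalgebra.comul (R := k) h)))
    rw [LinearMap.lTensor_id, slotCoact, coact_tmul_of_cocomm]
    rfl
  | succ q ih =>
    rw [descProd_succ_right, Module.End.mul_apply, slotCoact, coact_tmul_of_cocomm]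
    change _ = actLegs rho (q + 1) a (tpowCons k H (q + 1)
      (LinearMap.lTensor H (comulIter k H (q + 1)) (Coalgebra.comul (R := k) h)))
    induction (Coalgebra.comul (R := k) h) with
    | zero => simp only [map_zero]
    | add u v hu hv => simp only [map_add, hu, hv]
    | tmul u v =>
      rw [LinearMap.lTensor_tmul, actLegs_succ_tmul, ← ih, ← descProd_slotCoact_lTensor_cons]
      rfl

/-- The map `h ↦ h ⊗ g₀ ⊗ ⋯ ⊗ g_{p-1}`. -/
def consTpow : (p : ℕ) → (Fin p → H) → (H →ₗ[k] Tpow k H p)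
  | 0, _ => LinearMap.id
  | p + 1, g => (tpowCons k H p).toLinearMap ∘ₗ (TensorProduct.mk k H _).flip (tpow k H p g)

theorem consTpow_apply (p : ℕ) (g : Fin p → H) (h : H) :
    consTpow p g h = tpow k H p (Fin.cases h g) := by
  cases p <;> rfl

theorem lTensor_tpowProd_comul_consTpow (p : ℕ) (g : Fin p → H) (h : H) :
    LinearMap.lTensor (Tpow k H p) (tpowProd k H p 1) (Coalgebra.comul (consTpow p g h)) =
      TensorProduct.map (consTpow p g) LinearMap.id (Coalgebra.comul (R := k) h) := by
  cases p with
  | zero => rfl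
  | succ p =>
    change LinearMap.lTensor _ _ (Coalgebra.comul (tpowCons k H p (h ⊗ₜ tpow k H p g))) = _
    have hy := congrArg (TensorProduct.rid k _)
      (Coalgebra.lTensor_counit_comul (R := k) (tpow k H p g))
    rw [TensorProduct.rid_tmul, one_smul] at hy
    change _ = TensorProduct.map ((tpowCons k H p).toLinearMap ∘ₗ
      (TensorProduct.mk k H _).flip (tpow k H p g)) _ _
    rw [comul_tpowCons]
    conv_rhs => rw [← hy]
    induction (Coalgebra.comul (R := k) h) with
    | zero => simp
    | add u v hu hv => simp only [map_add, add_tmul, hu, hv]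
    | tmul u v =>
    rw [TensorProduct.map_tmul, LinearMap.comp_apply, LinearMap.flip_apply]
    induction (Coalgebra.comul (R := k) (tpow k H p g)) with
    | zero => simp
    | add u v hu hv => simp only [map_add, add_tmul, tmul_add, hu, hv]
    | tmul y z =>
      simp [tpowProd_one_tpowCons, smul_tmul]

theorem IsCycT.eq_descProd [Coalgebra.IsCocomm k H] {p q : ℕ}
    {T : Module.End k ((Tpow k H p : Type) ⊗[k] (Tpow k A q : Type))}
    (hT : IsCycT k H A rho.toLinearMap p q T) :
    T = descProd (slotCoact rho q (tpowProd k H p 1)) (q + 1) *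
      LinearMap.rTensor (Tpow k A q) (tpowRot p) := by
  refine TensorProduct.ext (tpow_ext fun g => tpow_ext fun a => ?_)
  obtain ⟨R⟩ := nonempty_iterRepr k (q + 1) (g (Fin.last p))
  have hrot : tpowRot p (tpow k H p g) =
      consTpow (k := k) p (fun j => g j.castSucc) (g (Fin.last p)) := by
    rw [tpowRot_tpow_eq_cases, consTpow_apply]
  simp only [LinearMap.compr₂ₛₗ_apply, TensorProduct.mk_apply, Module.End.mul_apply,
    LinearMap.rTensor_tmul, hrot]
  rw [hT g a R, ← LinearMap.rTensor_tmul, descProd_slotCoact_rTensor rho q _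
    (lTensor_tpowProd_comul_consTpow p _), descProd_slotCoact_id, ← R.eq]
  simp only [map_sum, actLegs_tpow, LinearMap.rTensor_tmul, consTpow_apply]
  rfl

theorem IsCycTau.eq_slotCoact [Coalgebra.IsCocomm k H] {p q : ℕ}
    {T : Module.End k ((Tpow k H p : Type) ⊗[k] (Tpow k A q : Type))}
    (hT : IsCycTau k H A rho.toLinearMap p q T) :
    T = slotCoact rho q (HopfAlgebra.antipode k ∘ₗ tpowProd k H p (p + 1)) 0 *
      LinearMap.lTensor (Tpow k H p) (tpowRot q) := by
  have := tpow_isCocomm (k := k) (H := H) p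
  refine TensorProduct.ext (tpow_ext fun g => tpow_ext fun a => ?_)
  let R := fun i => (nonempty_iterRepr k 1 (g i)).some
  have hR : ∀ i, Coalgebra.comul (R := k) (g i) =
      ∑ e ∈ (R i).s, (R i).leg e 0 ⊗ₜ[k] (R i).leg e 1 := by
    intro i
    have h := (R i).eq
    change _ = LinearMap.lTensor H LinearMap.id (Coalgebra.comul (R := k) (g i)) at h
    rw [LinearMap.lTensor_id] at h
    exact h.symm
  simp only [LinearMap.compr₂ₛₗ_apply, TensorProduct.mk_apply, Module.End.mul_apply,
    LinearMap.lTensor_tmul, tpowRot_tpow_eq_cases]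
  rw [hT g a R, slotCoact, coact_tmul_of_cocomm, comul_tpow k H p g _ _ _ hR]
  simp only [map_sum, LinearMap.rTensor_tmul, TensorProduct.comm_tmul]
  refine Finset.sum_congr rfl fun e _ => ?_
  congr 1
  refine Eq.trans ?_ (slotAct_tpow rho q 0 _ _).symm
  congr 1
  ext c
  cases c using Fin.cases with
  | zero =>
    rw [Function.update_self, LinearMap.comp_apply, tpowProd_tpow]
    rfl
  | succ c =>
    rw [Function.update_of_ne (Fin.succ_ne_zero c)]
    rfl

end CyclicOperators

theorem pow_eq_descProd_mul_pow {k : Type} [Field k] {H : Type} [Ring H] [HopfAlgebra k H]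
    [Coalgebra.IsCocomm k H] {A : Type} [Ring A] [Algebra k A]
    (rho : H →ₐ[k] Module.End k A) (p q n : ℕ) (hn : n ≤ p + 1) :
    (descProd (slotCoact rho q (tpowProd k H p 1)) (q + 1) *
      LinearMap.rTensor (Tpow k A q) (tpowRot p)) ^ n =
    descProd (slotCoact rho q (tpowProd k H p n)) (q + 1) *
      (LinearMap.rTensor (Tpow k A q) (tpowRot p) : Module.End k _) ^ n := by
  have := tpow_isCocomm (k := k) (H := H) p
  induction n with
  | zero =>
    rw [descProd_eq_one fun i => slotCoact_eq_one rho q (tpowProd_zero k H p) i]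
    simp
  | succ n ih =>
    obtain ⟨ψ, h1, h2⟩ := exists_tpowProd_rot k H p n (by omega)
    have hP : SemiconjBy (LinearMap.rTensor (Tpow k A q) (tpowRot p) : Module.End k _)
        (descProd (slotCoact rho q (tpowProd k H p n)) (q + 1))
        (descProd (slotCoact rho q ψ) (q + 1)) := by
      refine LinearMap.ext fun z => (descProd_slotCoact_rTensor rho q _ (fun d => ?_) _ z).symm
      rw [comul_tpowRot, ← LinearMap.comp_apply, LinearMap.lTensor_comp_map]
      congr 2
      exact (LinearMap.ext h1).symm
    rw [pow_succ', ih (by omega), mul_assoc, ← mul_assoc (LinearMap.rTensor _ _), hP.eq,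
      mul_assoc, ← mul_assoc, descProd_mul_descProd
        (fun i j hij => slotCoact_commute rho q _ _ hij)
        (fun i => slotCoact_mul rho q h2 i), ← pow_succ']

/-- Under the standing assumptions, the operators `t` and `τ` on
`H^{⊗(p+1)} ⊗ A^{⊗(q+1)}` satisfy the cylindrical module condition
`t^{p+1} ∘ τ^{q+1} = id`. -/
theorem cylindrical_condition
    (k : Type) [Field k] (H : Type) [Ring H] [HopfAlgebra k H]
    (A : Type) [Ring A] [Algebra k A]
    (rho : H →ₗ[k] A →ₗ[k] A) (sg : H →ₗ[k] H →ₗ[k] k)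
    (hco : Cocomm k H) (hma : IsModuleAlgebraAction k H A rho)
    (hnorm : NormalKA k H A sg) (hcoc : CocycleKA k H A sg)
    (htw : TwistedModuleK k H A rho sg) (hinv : ConvInvertibleK k H A sg)
    (p q : ℕ)
    (T Tau : Module.End k ((Tpow k H p : Type) ⊗[k] (Tpow k A q : Type)))
    (hT : IsCycT k H A rho p q T)
    (hTau : IsCycTau k H A rho p q Tau) :
    T ^ (p + 1) * Tau ^ (q + 1) = 1 := by
  have : Coalgebra.IsCocomm k H := ⟨LinearMap.ext hco⟩
  have := tpow_isCocomm (k := k) (H := H) p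
  let act : H →ₐ[k] Module.End k A := AlgHom.ofLinearMap rho
    (LinearMap.ext hma.1.2.2) fun h l => LinearMap.ext (hma.2 h l)
  have hT' := IsCycT.eq_descProd act (T := T) hT
  have hTau' := IsCycTau.eq_slotCoact act (T := Tau) hTau
  have hP : (LinearMap.rTensor (Tpow k A q) (tpowRot p) : Module.End k _) ^ (p + 1) =
      (1 : Module.End k ((Tpow k H p : Type) ⊗[k] (Tpow k A q : Type))) := by
    rw [LinearMap.rTensor_pow, tpowRot_pow]
    exact LinearMap.rTensor_id _ _
  have hQ : (LinearMap.lTensor (Tpow k H p) (tpowRot q) : Module.End k _) ^ (q + 1) =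
      (1 : Module.End k ((Tpow k H p : Type) ⊗[k] (Tpow k A q : Type))) := by
    rw [LinearMap.lTensor_pow, tpowRot_pow]
    exact LinearMap.lTensor_id _ _
  rw [hT', pow_eq_descProd_mul_pow act p q (p + 1) le_rfl, hP, mul_one, hTau',
    mul_pow_eq_ascProd (E := slotCoact act q (HopfAlgebra.antipode k ∘ₗ tpowProd k H p (p + 1)))
      (fun j hj => slotCoact_lTensor_tpowRot act q _ hj) (q + 1) le_rfl, hQ,
    mul_one]
  refine descProd_mul_ascProd (fun i => ?_) (q + 1)
  rw [slotCoact_mul act q (fun c => rfl :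
    ∀ c, (LinearMap.mul' k H ∘ₗ TensorProduct.map (tpowProd k H p (p + 1))
      (HopfAlgebra.antipode k ∘ₗ tpowProd k H p (p + 1)) ∘ₗ Coalgebra.comul) c = _)]
  exact slotCoact_eq_one act q (tpowProd_mul_antipode k H p) i
end
end
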